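/- arXiv:2106.10320 — 2 statements merged into one kernel-verified Lean document; each statement's English description precedes it below -/
import Mathlib

section
/- Fix a real number z with 0 < z < 1/4 and let w := e^{2πiz}. Then, as τ → 0 in ℍ with |Re τ| ≤ M·Im τ for some fixed M > 0, V(w;q) ~ (√2/4)·(w^{−1/2}/(1+w^{−1}))·q₀^{z²/2 − 1/16}·h(2z;2τ), i.e. the ratio of the two sides tends to 1. -/
open Complex Real Filter Topology

noncomputable section

/-- The Mordell integral `h(z;τ)`. -/
def mordell (z : ℝ) (τ : ℂ) : ℂ :=
  ∫ x : ℝ, Complex.exp (π * I * τ * (x : ℂ) ^ 2 - 2 * π * (z : ℂ) * (x : ℂ)) /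
    Complex.cosh (π * (x : ℂ))

/-- The Jacobi theta function `ϑ(z;τ)`. -/
def jtheta (z τ : ℂ) : ℂ :=
  ∑' n : ℤ, Complex.exp (π * I * ((n : ℂ) + 1 / 2) ^ 2 * τ +
    2 * π * I * ((n : ℂ) + 1 / 2) * (z + 1 / 2))

/-- The level-one Appell sum `A₁(u,v;τ)`. -/
def appell (u v τ : ℂ) : ℂ :=
  Complex.exp (π * I * u) * ∑' n : ℤ, (-1 : ℂ) ^ n * Complex.exp (2 * π * I * (n : ℂ) * v) *
    Complex.exp (π * I * (n : ℂ) * ((n : ℂ) + 1) * τ) /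
    (1 - Complex.exp (2 * π * I * u) * Complex.exp (2 * π * I * (n : ℂ) * τ))

/-- The Appell-Lerch function `μ(u,v;τ) = A₁(u,v;τ)/ϑ(v;τ)`. -/
def mu (u v τ : ℂ) : ℂ := appell u v τ / jtheta v τ

/-- Dedekind's eta function. -/
def eta (τ : ℂ) : ℂ :=
  Complex.exp (π * I * τ / 12) * ∏' n : ℕ, (1 - Complex.exp (2 * π * I * τ * ((n : ℂ) + 1)))

/-- The generating function `V(w;q)` of odd-balanced unimodal sequences. -/
def Vgen (w q : ℂ) : ℂ :=
  ∑' n : ℕ, ((∏ j ∈ Finset.range n, (1 + w * q ^ (j + 1))) *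
    (∏ j ∈ Finset.range n, (1 + w⁻¹ * q ^ (j + 1))) * q ^ n) /
    ∏ j ∈ Finset.range (n + 1), (1 - q ^ (2 * j + 1))

/-- The angular region `|Re τ| ≤ M Im τ` in the upper half-plane. -/
def angleRegion (M : ℝ) : Set ℂ := {τ : ℂ | 0 < τ.im ∧ |τ.re| ≤ M * τ.im}



/-- `1/(q;q)_j` for integer `j`, zero for negative `j`. -/
def irq (q : ℂ) (j : ℤ) : ℂ :=
  if j < 0 then 0 else (∏ i ∈ Finset.range j.toNat, (1 - q ^ (i + 1)))⁻¹

/-- `(q²;q²)_n` -/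
def nqq (q : ℂ) (n : ℕ) : ℂ := ∏ i ∈ Finset.range n, (1 - q ^ (2 * (i + 1)))

def acf (q : ℂ) (n : ℕ) (k : ℤ) : ℂ := nqq q n * irq q (n - k) * irq q (n + k + 1)

def gq (t : ℂ) (k : ℤ) : ℂ := Complex.exp (-t * ((k : ℂ) * (k + 1) / 2))

lemma one_sub_qpow_ne {q : ℂ} (hq : ‖q‖ < 1) (i : ℕ) : 1 - q ^ (i + 1) ≠ 0 := by
  intro h
  have h1 : q ^ (i + 1) = 1 := by linear_combination -h
  have h2 : ‖q‖ ^ (i + 1) = 1 := by rw [← norm_pow, h1, norm_one]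
  have h3 : ‖q‖ ^ (i + 1) < 1 := pow_lt_one₀ (norm_nonneg _) hq (by omega)
  linarith

lemma irq_rec {q : ℂ} (hq : ‖q‖ < 1) (j : ℤ) : irq q (j - 1) = (1 - q ^ j) * irq q j := by
  rcases lt_trichotomy j 0 with h | h | h
  · simp [irq, h, show j - 1 < 0 by omega]
  · subst h; simp [irq]
  · obtain ⟨m, rfl⟩ : ∃ m : ℕ, j = m + 1 := ⟨(j - 1).toNat, by omega⟩
    have h1 : ¬ ((m : ℤ) + 1 - 1 < 0) := by omega
    have h2 : ¬ ((m : ℤ) + 1 < 0) := by omega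
    have h3 : ((m : ℤ) + 1 - 1).toNat = m := by omega
    have h4 : ((m : ℤ) + 1).toNat = m + 1 := by omega
    have h5 : q ^ ((m : ℤ) + 1) = q ^ (m + 1) := by exact_mod_cast zpow_natCast q (m + 1)
    simp only [irq, h1, h2, h3, h4, if_false]
    rw [h5, Finset.prod_range_succ, mul_inv]
    have := one_sub_qpow_ne hq m
    field_simp

lemma nqq_succ (q : ℂ) (n : ℕ) : nqq q (n + 1) = nqq q n * (1 - q ^ (2 * (n + 1))) := by
  simp [nqq, Finset.prod_range_succ]

lemma gq_succ (t : ℂ) (k : ℤ) : gq t (k + 1) = gq t k * Complex.exp (-t) ^ (k + 1) := by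
  rw [← Complex.exp_int_mul, gq, gq, ← Complex.exp_add]
  congr 1; push_cast; ring

lemma gq_pred (t : ℂ) (k : ℤ) : gq t (k - 1) = gq t k * Complex.exp (-t) ^ (-k) := by
  rw [← Complex.exp_int_mul, gq, gq, ← Complex.exp_add]
  congr 1; push_cast; ring

lemma acf_rec {q : ℂ} (hq : ‖q‖ < 1) (hq0 : q ≠ 0) (n : ℕ) (k : ℤ) :
    acf q (n + 1) k * (1 - q ^ (2 * (n + 1) + 1)) =
      (1 + q ^ (2 * (n + 1))) * acf q n k + q ^ (n + 1) * q ^ (-k) * acf q n (k - 1)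
        + q ^ (n + 1) * q ^ (k + 1) * acf q n (k + 1) := by
  have e1 : irq q ((n : ℤ) - k) = (1 - q ^ ((n : ℤ) + 1 - k)) * irq q (n + 1 - k) := by
    rw [← irq_rec hq]; congr 1; ring
  have e2 : irq q ((n : ℤ) - (k + 1)) = (1 - q ^ ((n : ℤ) - k)) * ((1 - q ^ ((n : ℤ) + 1 - k)) * irq q (n + 1 - k)) := by
    rw [← e1, ← irq_rec hq]; congr 1; ring
  have e3 : irq q ((n : ℤ) + k + 1) = (1 - q ^ ((n : ℤ) + k + 2)) * irq q (n + k + 2) := by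
    rw [← irq_rec hq]; congr 1; ring
  have e4 : irq q ((n : ℤ) + (k - 1) + 1) = (1 - q ^ ((n : ℤ) + k + 1)) * ((1 - q ^ ((n : ℤ) + k + 2)) * irq q (n + k + 2)) := by
    rw [← e3, ← irq_rec hq]; congr 1; ring
  have e5 : (n : ℤ) - (k - 1) = n + 1 - k := by ring
  have e6 : (n : ℤ) + (k + 1) + 1 = n + k + 2 := by ring
  have e7 : ((n + 1 : ℕ) : ℤ) - k = n + 1 - k := by push_cast; ring
  have e8 : ((n + 1 : ℕ) : ℤ) + k + 1 = n + k + 2 := by push_cast; ring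
  simp only [acf, nqq_succ]
  rw [e7, e8, e5, e6, e1, e2, e3, e4]
  generalize irq q (n + 1 - k) = X
  generalize irq q (n + k + 2) = Y
  have z1 : q ^ ((n : ℤ) + 1 - k) = q ^ n * q * (q ^ k)⁻¹ := by
    rw [zpow_sub₀ hq0, zpow_add₀ hq0]; simp [div_eq_mul_inv]
  have z2 : q ^ ((n : ℤ) - k) = q ^ n * (q ^ k)⁻¹ := by
    rw [zpow_sub₀ hq0]; simp [div_eq_mul_inv]
  have z3 : q ^ ((n : ℤ) + k + 2) = q ^ n * q ^ k * q ^ 2 := by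
    rw [zpow_add₀ hq0, zpow_add₀ hq0]; norm_cast
  have z4 : q ^ ((n : ℤ) + k + 1) = q ^ n * q ^ k * q := by
    rw [zpow_add₀ hq0, zpow_add₀ hq0]; simp
  rw [z1, z2, z3, z4, zpow_neg, zpow_add₀ hq0, zpow_one]
  have hk : q ^ k ≠ 0 := zpow_ne_zero _ hq0
  generalize q ^ k = K at *
  field_simp
  ring

/-- telescoping term -/
def tcf (q : ℂ) (k : ℤ) (n : ℕ) : ℂ := nqq q n * irq q (n - k - 1) * irq q (n + k + 1)

lemma tcf_rec {q : ℂ} (hq : ‖q‖ < 1) (hq0 : q ≠ 0) (n : ℕ) (k : ℤ) :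
    tcf q k (n + 1) - tcf q k n =
      q ^ (-k) * (q ^ n * acf q n k) + q ^ (k + 2) * (q ^ n * acf q n (k + 1)) := by
  have e1 : irq q ((n : ℤ) - k - 1) = (1 - q ^ ((n : ℤ) - k)) * irq q (n - k) := irq_rec hq _
  have e2 : irq q ((n : ℤ) - (k + 1)) = (1 - q ^ ((n : ℤ) - k)) * irq q (n - k) := by
    rw [← irq_rec hq]; congr 1; ring
  have e3 : irq q ((n : ℤ) + k + 1) = (1 - q ^ ((n : ℤ) + k + 2)) * irq q (n + k + 2) := by
    rw [← irq_rec hq]; congr 1; ring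
  have e6 : (n : ℤ) + (k + 1) + 1 = n + k + 2 := by ring
  have e7 : ((n + 1 : ℕ) : ℤ) - k - 1 = n - k := by push_cast; ring
  have e8 : ((n + 1 : ℕ) : ℤ) + k + 1 = n + k + 2 := by push_cast; ring
  simp only [acf, tcf, nqq_succ]
  rw [e7, e8, e6, e1, e2, e3]
  generalize irq q (n - k) = X
  generalize irq q (n + k + 2) = Y
  have z2 : q ^ ((n : ℤ) - k) = q ^ n * (q ^ k)⁻¹ := by
    rw [zpow_sub₀ hq0]; simp [div_eq_mul_inv]
  have z3 : q ^ ((n : ℤ) + k + 2) = q ^ n * q ^ k * q ^ 2 := by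
    rw [zpow_add₀ hq0, zpow_add₀ hq0]; norm_cast
  have z4 : q ^ (k + 2) = q ^ k * q ^ 2 := by
    rw [zpow_add₀ hq0]; norm_cast
  rw [z2, z3, z4, zpow_neg]
  have hk : q ^ k ≠ 0 := zpow_ne_zero _ hq0
  generalize q ^ k = K at *
  field_simp
  ring

lemma acf_symm (q : ℂ) (n : ℕ) (k : ℤ) : acf q n (-1 - k) = acf q n k := by
  simp only [acf]
  rw [show (n : ℤ) - (-1 - k) = n + k + 1 by ring, show (n : ℤ) + (-1 - k) + 1 = n - k by ring]
  ring

lemma hasSum_shift_sub {f : ℤ → ℂ} {a : ℂ} (h : HasSum f a) : HasSum (fun k => f (k - 1)) a :=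
  (Equiv.subRight (1:ℤ)).hasSum_iff.mpr h

lemma hasSum_shift_add {f : ℤ → ℂ} {a : ℂ} (h : HasSum f a) : HasSum (fun k => f (k + 1)) a :=
  (Equiv.addRight (1:ℤ)).hasSum_iff.mpr h

lemma hasSum_congr2 {ι : Type*} {f g : ι → ℂ} {a b : ℂ} (h : HasSum f a) (hf : ∀ k, g k = f k)
    (hb : b = a) : HasSum g b := by
  rw [hb, show g = f from funext hf]; exact h

/-- finite Jacobi triple product -/
lemma hasSum_acf (t w : ℂ) (ht : 0 < t.re) (hw : w ≠ 0) (n : ℕ) :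
    HasSum (fun k : ℤ => w ^ k * gq t k * acf (Complex.exp (-t)) n k)
      ((1 + w⁻¹) * (((∏ j ∈ Finset.range n, (1 + w * Complex.exp (-t) ^ (j + 1))) *
    (∏ j ∈ Finset.range n, (1 + w⁻¹ * Complex.exp (-t) ^ (j + 1)))) /
    ∏ j ∈ Finset.range (n + 1), (1 - Complex.exp (-t) ^ (2 * j + 1)))) := by
  have hq : ‖Complex.exp (-t)‖ < 1 := by
    rw [Complex.norm_exp]; simpa using ht
  have hq0 : Complex.exp (-t) ≠ 0 := Complex.exp_ne_zero _
  induction n with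
  | zero =>
    have key : ∀ k : ℤ, k ∉ ({-1, 0} : Finset ℤ) → w ^ k * gq t k * acf (Complex.exp (-t)) 0 k = 0 := by
      intro k hk
      have : k < -1 ∨ 0 < k := by
        simp at hk; omega
      rcases this with h | h
      · simp [acf, irq, show k + 1 < 0 by omega]
      · simp [acf, irq, h]
    have hs : HasSum (fun k : ℤ => w ^ k * gq t k * acf (Complex.exp (-t)) 0 k)
        (∑ k ∈ ({-1, 0} : Finset ℤ), w ^ k * gq t k * acf (Complex.exp (-t)) 0 k) :=
      hasSum_sum_of_ne_finset_zero key
    convert hs using 1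
    have h1 := one_sub_qpow_ne hq 0
    simp [acf, irq, gq, nqq]
    ring
  | succ n ih =>
    set q := Complex.exp (-t) with hqd
    have s1 := hasSum_shift_sub ih
    have s2 := hasSum_shift_add ih
    have hne : 1 - q ^ (2 * (n + 1) + 1) ≠ 0 := one_sub_qpow_ne hq _
    have s3 := (((ih.mul_left (1 + q ^ (2 * (n + 1)))).add (s1.mul_left (w * q ^ (n+1)))).add
      (s2.mul_left (w⁻¹ * q ^ (n+1)))).div_const (1 - q ^ (2 * (n + 1) + 1))
    refine hasSum_congr2 s3 (fun k => ?_) ?_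
    · show w ^ k * gq t k * acf q (n + 1) k = _
      rw [eq_div_iff hne, mul_assoc (w ^ k * gq t k), acf_rec hq hq0, gq_pred, gq_succ, ← hqd,
        zpow_sub₀ hw, zpow_add₀ hw, zpow_one]
      field_simp
    · rw [Finset.prod_range_succ, Finset.prod_range_succ, Finset.prod_range_succ _ (n+1)]
      rw [eq_div_iff hne]
      have : ∏ j ∈ Finset.range (n + 1), (1 - q ^ (2 * j + 1)) ≠ 0 := by
        rw [Finset.prod_ne_zero_iff]; intro j _; exact one_sub_qpow_ne hq _
      field_simp
      ring

lemma gsum_le {a : ℝ} (ha : 0 < a) :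
    Summable (fun k : ℤ => Real.exp (-a * ((k : ℝ) * (k + 1) / 2))) ∧
    ∑' k : ℤ, Real.exp (-a * ((k : ℝ) * (k + 1) / 2)) ≤ 2 / (1 - Real.exp (-a)) := by
  have hr : Real.exp (-a) < 1 := by simpa using ha
  have hb : ∀ m : ℕ, Real.exp (-a * ((m : ℝ) * (m + 1) / 2)) ≤ Real.exp (-a) ^ m := by
    intro m
    rw [← Real.exp_nat_mul]
    apply Real.exp_le_exp.mpr
    have : (m : ℝ) ≤ m * (m + 1) / 2 := by
      rcases Nat.eq_zero_or_pos m with h | h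
      · simp [h]
      · have : (1 : ℝ) ≤ m := by exact_mod_cast h
        nlinarith
    nlinarith
  have hg := hasSum_geometric_of_lt_one (Real.exp_nonneg (-a)) hr
  have s0 : Summable (fun m : ℕ => Real.exp (-a * ((m : ℝ) * (m + 1) / 2))) :=
    Summable.of_nonneg_of_le (fun m => (Real.exp_nonneg _)) hb hg.summable
  have l0 : ∑' m : ℕ, Real.exp (-a * ((m : ℝ) * (m + 1) / 2)) ≤ (1 - Real.exp (-a))⁻¹ := by
    rw [← hg.tsum_eq]; exact s0.tsum_le_tsum hb hg.summable
  have h1 : HasSum (fun m : ℕ => Real.exp (-a * ((((m : ℤ)) : ℝ) * ((m : ℤ) + 1) / 2)))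
      (∑' m : ℕ, Real.exp (-a * ((m : ℝ) * (m + 1) / 2))) := by
    simpa using s0.hasSum
  have h2 : HasSum (fun m : ℕ => Real.exp (-a * (((-((m : ℤ) + 1) : ℤ) : ℝ) * ((-((m : ℤ) + 1) : ℤ) + 1) / 2)))
      (∑' m : ℕ, Real.exp (-a * ((m : ℝ) * (m + 1) / 2))) := by
    have := s0.hasSum
    refine this.congr_fun ?_ |> fun h => h
    intro m
    congr 1; push_cast; ring
  have h3 := HasSum.of_nat_of_neg_add_one (f := fun k : ℤ => Real.exp (-a * ((k : ℝ) * (k + 1) / 2))) h1 h2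
  refine ⟨h3.summable, ?_⟩
  rw [h3.tsum_eq, div_eq_mul_inv]; linarith

lemma norm_gq (t : ℂ) (k : ℤ) : ‖gq t k‖ = Real.exp (-t.re * ((k : ℝ) * (k + 1) / 2)) := by
  rw [gq, Complex.norm_exp]
  congr 1
  have : ((k : ℂ) * (k + 1) / 2) = (((k : ℝ) * (k + 1) / 2 : ℝ) : ℂ) := by push_cast; ring
  rw [this, Complex.re_mul_ofReal]; simp

lemma tendsto_qprod {q : ℂ} (hq : ‖q‖ < 1) :
    ∃ L : ℂ, L ≠ 0 ∧ Tendsto (fun N : ℕ => ∏ i ∈ Finset.range N, (1 - q ^ (i + 1))) atTop (𝓝 L) := by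
  have hs : Summable (fun i : ℕ => ‖-q ^ (i + 1)‖) := by
    simp only [norm_neg, norm_pow]
    exact (summable_nat_add_iff 1).mpr (summable_geometric_of_lt_one (norm_nonneg _) hq)
  have h1 := multipliable_one_add_of_summable hs
  have h2 : ∏' i : ℕ, (1 + -q ^ (i + 1)) ≠ 0 := by
    apply tprod_one_add_ne_zero_of_summable (fun i => ?_) hs
    rw [← sub_eq_add_neg]; exact one_sub_qpow_ne hq i
  refine ⟨_, h2, ?_⟩
  have := h1.hasProd.tendsto_prod_nat
  simpa [sub_eq_add_neg] using this

lemma irq_bdd {q : ℂ} (hq : ‖q‖ < 1) : ∃ C : ℝ, ∀ j, ‖irq q j‖ ≤ C := by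
  obtain ⟨L, hL, h⟩ := tendsto_qprod hq
  have h' := h.inv₀ hL
  obtain ⟨C, hC⟩ := (Metric.isBounded_range_of_tendsto _ h').exists_norm_le
  refine ⟨C, fun j => ?_⟩
  have hC0 : 0 ≤ C := (norm_nonneg _).trans (hC _ ⟨0, rfl⟩)
  unfold irq
  split_ifs
  · simpa using hC0
  · exact hC _ ⟨j.toNat, rfl⟩

lemma nqq_tendsto {q : ℂ} (hq : ‖q‖ < 1) : ∃ L : ℂ, L ≠ 0 ∧ Tendsto (nqq q) atTop (𝓝 L) := by
  have : ‖q ^ 2‖ < 1 := by rw [norm_pow]; exact pow_lt_one₀ (norm_nonneg _) hq (by norm_num)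
  obtain ⟨L, hL, h⟩ := tendsto_qprod this
  refine ⟨L, hL, ?_⟩
  exact h.congr fun N => by simp [nqq, pow_mul]

lemma acf_bdd {q : ℂ} (hq : ‖q‖ < 1) : ∃ C : ℝ, 0 ≤ C ∧ ∀ n k, ‖acf q n k‖ ≤ C := by
  obtain ⟨C, hC⟩ := irq_bdd hq
  obtain ⟨L, hL, h⟩ := nqq_tendsto hq
  obtain ⟨D, hD⟩ := (Metric.isBounded_range_of_tendsto _ h).exists_norm_le
  have hC0 : 0 ≤ C := (norm_nonneg _).trans (hC 0)
  have hD0 : 0 ≤ D := (norm_nonneg _).trans (hD _ ⟨0, rfl⟩)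
  refine ⟨D * C * C, by positivity, fun n k => ?_⟩
  rw [acf, norm_mul, norm_mul]
  gcongr
  · exact hD _ ⟨n, rfl⟩
  · exact hC _
  · exact hC _

lemma tcf_tendsto {q : ℂ} (hq : ‖q‖ < 1) : ∃ P : ℂ, P ≠ 0 ∧ ∀ k, Tendsto (tcf q k) atTop (𝓝 P) := by
  obtain ⟨L, hL, h⟩ := tendsto_qprod hq
  obtain ⟨L', hL', h'⟩ := nqq_tendsto hq
  have key : ∀ c : ℤ, Tendsto (fun n : ℕ => irq q (n + c)) atTop (𝓝 L⁻¹) := by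
    intro c
    have ht : Tendsto (fun n : ℕ => ((n : ℤ) + c).toNat) atTop atTop := by
      apply tendsto_atTop.mpr
      intro b
      filter_upwards [eventually_ge_atTop (b + c.natAbs)] with n hn
      omega
    refine ((h.inv₀ hL).comp ht).congr' ?_
    filter_upwards [eventually_ge_atTop (c.natAbs)] with n hn
    have : ¬ ((n : ℤ) + c < 0) := by omega
    simp [irq, this]
  refine ⟨L' * L⁻¹ * L⁻¹, by simp [hL, hL'], fun k => ?_⟩
  have := (h'.mul (key (-k - 1))).mul (key (k + 1))
  refine this.congr (fun n => ?_)
  simp only [tcf]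
  rw [show (n : ℤ) + (-k - 1) = n - k - 1 by ring, show (n : ℤ) + (k + 1) = n + k + 1 by ring]

/-- `S_k` -/
def Sk (q : ℂ) (k : ℤ) : ℂ := ∑' n : ℕ, q ^ n * acf q n k

lemma Sk_summable {q : ℂ} (hq : ‖q‖ < 1) (k : ℤ) : Summable (fun n : ℕ => q ^ n * acf q n k) := by
  obtain ⟨C, hC0, hC⟩ := acf_bdd hq
  refine Summable.of_norm_bounded (g := fun n : ℕ => ‖q‖ ^ n * C)
    ((summable_geometric_of_lt_one (norm_nonneg _) hq).mul_right C) (fun n => ?_)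
  rw [norm_mul, norm_pow]; gcongr; exact hC _ _

lemma Sk_bdd {q : ℂ} (hq : ‖q‖ < 1) : ∃ C : ℝ, 0 ≤ C ∧ ∀ k, ‖Sk q k‖ ≤ C := by
  obtain ⟨C, hC0, hC⟩ := acf_bdd hq
  have hg := ((hasSum_geometric_of_lt_one (norm_nonneg q) hq).mul_right C)
  refine ⟨_, hg.nonneg (fun n => by positivity), fun k => ?_⟩
  apply tsum_of_norm_bounded hg
  intro n
  rw [norm_mul, norm_pow]; gcongr; exact hC _ _

lemma Sk_symm (q : ℂ) (k : ℤ) : Sk q (-1 - k) = Sk q k := by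
  simp [Sk, acf_symm]

lemma Sk_rec {q : ℂ} (hq : ‖q‖ < 1) (hq0 : q ≠ 0) {P : ℂ} (hP : ∀ k, Tendsto (tcf q k) atTop (𝓝 P))
    (k : ℤ) : q ^ (-k) * Sk q k + q ^ (k + 2) * Sk q (k + 1) = P - tcf q k 0 := by
  have h1 := (((Sk_summable hq k).hasSum.mul_left (q ^ (-k))).add
    ((Sk_summable hq (k + 1)).hasSum.mul_left (q ^ (k + 2)))).tendsto_sum_nat
  have h2 : Tendsto (fun N => tcf q k N - tcf q k 0) atTop (𝓝 (P - tcf q k 0)) :=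
    (hP k).sub_const _
  refine tendsto_nhds_unique h1 (h2.congr fun N => ?_)
  rw [← Finset.sum_range_sub]
  exact Finset.sum_congr rfl fun n _ => tcf_rec hq hq0 n k

lemma qexp_zpow (t : ℂ) (k : ℤ) : Complex.exp (-t) ^ k = Complex.exp (-t * k) := by
  rw [← Complex.exp_int_mul]; congr 1; ring

theorem step1 (t w : ℂ) (ht : 0 < t.re) (hw : ‖w‖ = 1) :
    ∃ p : ℤ → ℂ, (∀ k, p (-1 - k) = p k) ∧
      (∀ k : ℕ, p k + p (k + 1) = Complex.exp (-t * ((k : ℂ) + 1) ^ 2)) ∧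
      Tendsto (fun k : ℕ => p k) atTop (𝓝 0) ∧
      Summable (fun k : ℤ => w ^ k * gq t k * Complex.exp (t * ((k : ℂ) ^ 2 + k + 1)) * p k) ∧
      (1 + w⁻¹) * Vgen w (Complex.exp (-t)) *
        ∑' n : ℤ, Complex.exp (-t * (n : ℂ) ^ 2 + π * I * n) =
      ∑' k : ℤ, w ^ k * gq t k * Complex.exp (t * ((k : ℂ) ^ 2 + k + 1)) * p k := by
  set q := Complex.exp (-t) with hqd
  have hq : ‖q‖ < 1 := by
    rw [hqd, Complex.norm_exp]; simpa using ht
  have hq0 : q ≠ 0 := Complex.exp_ne_zero _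
  have hw0 : w ≠ 0 := by intro h; simp [h] at hw
  obtain ⟨P, hP0, hP⟩ := tcf_tendsto hq
  obtain ⟨C, hC0, hC⟩ := Sk_bdd hq
  have hee : ∀ k : ℤ, Complex.exp (t * ((k : ℂ) ^ 2 + k + 1)) * Complex.exp (-t * ((k : ℂ) ^ 2 + k + 1)) = 1 := by
    intro k; rw [← Complex.exp_add]; simp
  have hsg : Summable (fun k : ℤ => w ^ k * gq t k * Sk q k) := by
    refine Summable.of_norm_bounded ((gsum_le ht).1.mul_right C) (fun k => ?_)
    rw [norm_mul, norm_mul, norm_zpow, hw, one_zpow, one_mul, norm_gq]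
    gcongr; exact hC k
  have hterm : ∀ k : ℤ, w ^ k * gq t k * Complex.exp (t * ((k : ℂ) ^ 2 + k + 1)) *
      (Complex.exp (-t * ((k : ℂ) ^ 2 + k + 1)) * Sk q k / P) = w ^ k * gq t k * Sk q k * P⁻¹ := by
    intro k
    have := hee k
    rw [div_eq_mul_inv]
    linear_combination (w ^ k * gq t k * Sk q k * P⁻¹) * this
  have hrec : ∀ k : ℕ, Complex.exp (-t * (((k : ℤ) : ℂ) ^ 2 + (k : ℤ) + 1)) * Sk q k / P +
      Complex.exp (-t * ((((k : ℤ) + 1 : ℤ) : ℂ) ^ 2 + (((k : ℤ) + 1 : ℤ) : ℂ) + 1)) * Sk q (k + 1) / P =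
      Complex.exp (-t * ((k : ℂ) + 1) ^ 2) := by
    intro k
    have h := Sk_rec hq hq0 hP k
    have h0 : tcf q k 0 = 0 := by simp [tcf, irq, show (-(k : ℤ) - 1 < 0) by omega]
    rw [h0, sub_zero, qexp_zpow, qexp_zpow] at h
    rw [← add_div, div_eq_iff hP0, ← h, mul_add (Complex.exp (-t * ((k : ℂ) + 1) ^ 2)), ← mul_assoc, ← mul_assoc, ← Complex.exp_add,
      ← Complex.exp_add]
    congr 3
    · congr 1; push_cast; ring
    · congr 1; push_cast; ring
  have hlim : Tendsto (fun k : ℕ => Complex.exp (-t * (((k : ℤ) : ℂ) ^ 2 + (k : ℤ) + 1)) * Sk q k / P)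
      atTop (𝓝 0) := by
    have hg : Tendsto (fun k : ℕ => ‖q‖ ^ k * (C / ‖P‖)) atTop (𝓝 0) := by
      simpa using (tendsto_pow_atTop_nhds_zero_of_lt_one (norm_nonneg q) hq).mul_const (C / ‖P‖)
    refine squeeze_zero_norm (fun k => ?_) hg
    rw [norm_div, norm_mul, mul_div_assoc]
    gcongr
    · rw [hqd, ← norm_pow, ← Complex.exp_nat_mul, Complex.norm_exp, Complex.norm_exp]
      apply Real.exp_le_exp.mpr
      have : (((k : ℤ) : ℂ) ^ 2 + (k : ℤ) + 1) = (((k : ℝ) ^ 2 + k + 1 : ℝ) : ℂ) := by push_cast; ring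
      rw [this, Complex.re_mul_ofReal]
      simp
      nlinarith [sq_nonneg (k : ℝ)]
    · exact hC _
  refine ⟨fun k => Complex.exp (-t * ((k : ℂ) ^ 2 + k + 1)) * Sk q k / P, ?_, ?_, ?_, ?_, ?_⟩
  · intro k
    simp only [Sk_symm]
    congr 3; push_cast; ring
  · exact hrec
  · exact hlim
  · simp only [hterm]
    exact hsg.mul_right _
  · simp only [hterm]
    rw [tsum_mul_right]
    have hth : ∑' n : ℤ, Complex.exp (-t * (n : ℂ) ^ 2 + π * I * n) = P⁻¹ := by
      set p : ℕ → ℂ := fun k => Complex.exp (-t * (((k : ℤ) : ℂ) ^ 2 + (k : ℤ) + 1)) * Sk q k / P with hp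
      have hrec' : ∀ k, p k + p (k + 1) = Complex.exp (-t * ((k : ℂ) + 1) ^ 2) := by
        intro k; rw [← hrec k, hp]; push_cast; rfl
      have hsm : Summable (fun k : ℕ => (-1 : ℂ) ^ k * Complex.exp (-t * ((k : ℂ) + 1) ^ 2)) := by
        refine Summable.of_norm_bounded (summable_geometric_of_lt_one (norm_nonneg q) hq) (fun k => ?_)
        rw [norm_mul, norm_pow, norm_neg, norm_one, one_pow, one_mul]
        rw [hqd, ← norm_pow, ← Complex.exp_nat_mul, Complex.norm_exp, Complex.norm_exp]
        apply Real.exp_le_exp.mpr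
        have : ((k : ℂ) + 1) ^ 2 = (((k : ℝ) + 1 : ℝ) ^ 2 : ℝ) := by push_cast; ring
        rw [this, Complex.re_mul_ofReal]
        simp
        nlinarith [sq_nonneg (k : ℝ)]
      have hpart : ∀ N : ℕ, ∑ k ∈ Finset.range N, (-1 : ℂ) ^ k * Complex.exp (-t * ((k : ℂ) + 1) ^ 2)
          = p 0 - (-1) ^ N * p N := by
        intro N
        induction N with
        | zero => simp
        | succ N ih => rw [Finset.sum_range_succ, ih, ← hrec' N, pow_succ]; ring
      have hsum : HasSum (fun k : ℕ => (-1 : ℂ) ^ k * Complex.exp (-t * ((k : ℂ) + 1) ^ 2)) (p 0) := by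
        have h1 := hsm.hasSum.tendsto_sum_nat
        have h2 : Tendsto (fun N => p 0 - (-1) ^ N * p N) atTop (𝓝 (p 0 - 0)) := by
          apply Tendsto.sub tendsto_const_nhds
          apply squeeze_zero_norm (a := fun N => ‖p N‖) (fun N => by simp)
          simpa using hlim.norm
        rw [sub_zero] at h2
        have : ∑' k : ℕ, (-1 : ℂ) ^ k * Complex.exp (-t * ((k : ℂ) + 1) ^ 2) = p 0 :=
          tendsto_nhds_unique h1 (h2.congr fun N => (hpart N).symm)
        rw [← this]; exact hsm.hasSum
      have hpi : ∀ k : ℤ, Complex.exp (π * I * k) = (-1) ^ k := by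
        intro k; rw [mul_comm, Complex.exp_int_mul, Complex.exp_pi_mul_I]
      have a1 : HasSum (fun n : ℕ => Complex.exp (-t * (((n : ℤ)) : ℂ) ^ 2 + π * I * (n : ℤ))) (1 - p 0) := by
        rw [← hasSum_nat_add_iff' 1]
        have e := hsum.neg
        refine hasSum_congr2 e (fun k => ?_) ?_
        · rw [Complex.exp_add, hpi]; push_cast; rw [zpow_add₀ (by norm_num)]; simp; ring
        · simp
      have a2 : HasSum (fun n : ℕ => Complex.exp (-t * ((-((n : ℤ) + 1) : ℤ) : ℂ) ^ 2 + π * I * (-((n : ℤ) + 1) : ℤ))) (- p 0) := by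
        refine hasSum_congr2 hsum.neg (fun k => ?_) rfl
        rw [Complex.exp_add, hpi]
        rw [zpow_neg, zpow_add₀ (by norm_num)]; push_cast
        rcases neg_one_pow_eq_or ℂ k with h | h <;> simp [h] <;> ring_nf
      have a3 := HasSum.of_nat_of_neg_add_one (f := fun n : ℤ => Complex.exp (-t * (n : ℂ) ^ 2 + π * I * n)) a1 a2
      rw [a3.tsum_eq]
      have h := Sk_rec hq hq0 hP (-1)
      have h0 : tcf q (-1) 0 = 1 := by simp [tcf, irq, nqq]
      have h1 : Sk q (-1) = Sk q 0 := by simpa using Sk_symm q 0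
      rw [h0, h1] at h
      norm_num at h
      have h2 : p 0 = q * Sk q 0 / P := by simp [hp, hqd]
      rw [h2]
      field_simp
      linear_combination -h
    rw [hth]
    congr 1
    have hV : ∀ n : ℕ, (1 + w⁻¹) * (((∏ j ∈ Finset.range n, (1 + w * q ^ (j + 1))) *
    (∏ j ∈ Finset.range n, (1 + w⁻¹ * q ^ (j + 1))) * q ^ n) /
    ∏ j ∈ Finset.range (n + 1), (1 - q ^ (2 * j + 1))) = ∑' k : ℤ, w ^ k * gq t k * (q ^ n * acf q n k) := by
      intro n
      have := (hasSum_acf t w ht hw0 n).mul_right (q ^ n)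
      rw [← hqd] at this
      rw [show (fun k : ℤ => w ^ k * gq t k * (q ^ n * acf q n k)) = fun k => w ^ k * gq t k * acf q n k * q ^ n by
        ext k; ring]
      rw [this.tsum_eq]; ring
    rw [Vgen, ← tsum_mul_left]
    simp_rw [hV]
    obtain ⟨D, hD0, hD⟩ := acf_bdd hq
    have hsum2 : Summable (Function.uncurry fun (n : ℕ) (k : ℤ) => w ^ k * gq t k * (q ^ n * acf q n k)) := by
      have := (summable_geometric_of_lt_one (norm_nonneg q) hq).mul_of_nonneg ((gsum_le ht).1.mul_right D)
        (fun n => by positivity) (fun k => by positivity)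
      refine Summable.of_norm_bounded this (fun x => ?_)
      obtain ⟨n, k⟩ := x
      simp only [Function.uncurry]
      rw [norm_mul, norm_mul, norm_mul, norm_zpow, hw, one_zpow, one_mul, norm_gq, norm_pow, mul_left_comm]
      gcongr; exact hD _ _
    rw [← hsum2.tsum_comm]
    congr 1; ext k
    rw [tsum_mul_left, Sk]

lemma integrable_exp_neg_abs' {c : ℝ} (hc : 0 < c) : MeasureTheory.Integrable (fun x : ℝ => Real.exp (-c * |x|)) := by
  rw [← MeasureTheory.integrableOn_univ, ← Set.Iic_union_Ioi (a := (0:ℝ)), MeasureTheory.integrableOn_union]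
  constructor
  · refine (integrableOn_exp_mul_Iic hc 0).congr_fun (fun x hx => ?_) measurableSet_Iic
    simp only [Set.mem_Iic] at hx
    simp only [abs_of_nonpos hx]; congr 1; ring
  · refine (integrableOn_exp_mul_Ioi (neg_neg_of_pos hc) 0).congr_fun (fun x hx => ?_) measurableSet_Ioi
    simp only [Set.mem_Ioi] at hx
    simp only [abs_of_pos hx]

lemma norm_cosh_sq (u : ℂ) : ‖Complex.cosh u‖ ^ 2 = Real.sinh u.re ^ 2 + Real.cos u.im ^ 2 := by
  conv_lhs => rw [← Complex.re_add_im u, Complex.cosh_add, Complex.cosh_mul_I, Complex.sinh_mul_I]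
  rw [← Complex.normSq_eq_norm_sq, Complex.normSq_apply]
  simp [Complex.sinh_ofReal_re, Complex.cosh_ofReal_re, Complex.sin_ofReal_re, Complex.cos_ofReal_re]
  have h1 := Real.cosh_sq u.re
  have h2 := Real.sin_sq_add_cos_sq u.im
  linear_combination (Real.cos u.im)^2 * h1 + (Real.sinh u.re)^2 * h2

lemma norm_sinh_sq (u : ℂ) : ‖Complex.sinh u‖ ^ 2 = Real.sinh u.re ^ 2 + Real.sin u.im ^ 2 := by
  conv_lhs => rw [← Complex.re_add_im u, Complex.sinh_add, Complex.cosh_mul_I, Complex.sinh_mul_I]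
  rw [← Complex.normSq_eq_norm_sq, Complex.normSq_apply]
  simp [Complex.sinh_ofReal_re, Complex.cosh_ofReal_re, Complex.sin_ofReal_re, Complex.cos_ofReal_re]
  have h1 := Real.cosh_sq u.re
  have h2 := Real.sin_sq_add_cos_sq u.im
  linear_combination (Real.sin u.im)^2 * h1 + (Real.sinh u.re)^2 * h2

lemma abs_sinh_le_norm_cosh (u : ℂ) : |Real.sinh u.re| ≤ ‖Complex.cosh u‖ := by
  rw [← abs_of_nonneg (norm_nonneg (Complex.cosh u)), ← sq_le_sq, norm_cosh_sq]
  nlinarith [sq_nonneg (Real.cos u.im)]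

lemma abs_sinh_le_norm_sinh (u : ℂ) : |Real.sinh u.re| ≤ ‖Complex.sinh u‖ := by
  rw [← abs_of_nonneg (norm_nonneg (Complex.sinh u)), ← sq_le_sq, norm_sinh_sq]
  nlinarith [sq_nonneg (Real.sin u.im)]

lemma abs_cos_le_norm_cosh (u : ℂ) : |Real.cos u.im| ≤ ‖Complex.cosh u‖ := by
  rw [← abs_of_nonneg (norm_nonneg (Complex.cosh u)), ← sq_le_sq, norm_cosh_sq]
  nlinarith [sq_nonneg (Real.sinh u.re)]

lemma norm_sinh_le (u : ℂ) : ‖Complex.sinh u‖ ≤ Real.exp |u.re| := by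
  have h : ‖Complex.sinh u‖ ^ 2 ≤ (Real.exp |u.re|) ^ 2 := by
    rw [norm_sinh_sq]
    have h1 : Real.sinh u.re ^ 2 = Real.cosh |u.re| ^ 2 - 1 := by rw [Real.cosh_abs, Real.cosh_sq]; ring
    have h2 : Real.cosh |u.re| ≤ Real.exp |u.re| := by
      rw [Real.cosh_eq]
      have : Real.exp (-|u.re|) ≤ Real.exp |u.re| := by
        apply Real.exp_le_exp.mpr; linarith [abs_nonneg u.re]
      linarith
    have h3 := Real.sin_sq_le_one u.im
    have h4 := Real.cosh_pos |u.re|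
    nlinarith
  exact le_of_sq_le_sq h (Real.exp_nonneg _)

lemma sinh_lower {δ a : ℝ} (hδ : δ ≤ |a|) :
    (1 - Real.exp (-2 * δ)) / 2 * Real.exp |a| ≤ |Real.sinh a| := by
  rw [Real.abs_sinh, Real.sinh_eq]
  have : Real.exp (-|a|) ≤ Real.exp (-2 * δ) * Real.exp |a| := by
    rw [← Real.exp_add]; apply Real.exp_le_exp.mpr; linarith
  linarith

lemma cosh_lower {M : ℝ} (hM : 0 ≤ M) : ∃ c : ℝ, 0 < c ∧ ∀ u : ℂ, |u.im| ≤ M * |u.re| →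
    c * Real.exp |u.re| ≤ ‖Complex.cosh u‖ := by
  set δ := 1 / (1 + M) with hδ
  have hδ0 : 0 < δ := by positivity
  have hδ1 : δ ≤ 1 := by rw [hδ, div_le_one (by linarith)]; linarith
  refine ⟨min ((1 - Real.exp (-2 * δ)) / 2) (1 / 2 * Real.exp (-1)), ?_, ?_⟩
  · apply lt_min
    · have : Real.exp (-2 * δ) < 1 := by rw [Real.exp_lt_one_iff]; linarith
      linarith
    · positivity
  · intro u hu
    rcases le_total δ |u.re| with h | h
    · refine le_trans ?_ (abs_sinh_le_norm_cosh u)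
      refine le_trans ?_ (sinh_lower h)
      gcongr; exact min_le_left _ _
    · refine le_trans ?_ (abs_cos_le_norm_cosh u)
      have h1 : |u.im| ≤ 1 := by
        calc |u.im| ≤ M * |u.re| := hu
          _ ≤ M * δ := by gcongr
          _ ≤ 1 := by rw [hδ, mul_one_div, div_le_one (by linarith)]; linarith
      have h2 : 1 / 2 ≤ Real.cos u.im := by
        have := Real.one_sub_sq_div_two_le_cos (x := u.im)
        have h3 : u.im ^ 2 ≤ 1 := by rw [← sq_abs]; nlinarith [abs_nonneg u.im]
        linarith
      calc _ ≤ 1 / 2 * Real.exp (-1) * Real.exp |u.re| := by gcongr; exact min_le_right _ _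
        _ = 1 / 2 * Real.exp (-1 + |u.re|) := by rw [mul_assoc, Real.exp_add]
        _ ≤ 1 / 2 * 1 := by gcongr; rw [Real.exp_le_one_iff]; linarith
        _ ≤ _ := by linarith [le_abs_self (Real.cos u.im)]

/-- the integrand -/
def f0 (z : ℝ) (u : ℂ) : ℂ := Complex.exp (-(4 * π * z) * u) / Complex.cosh (π * u)

lemma cone_pi {M : ℝ} {u : ℂ} (h : |u.im| ≤ M * |u.re|) :
    |((π : ℂ) * u).im| ≤ M * |((π : ℂ) * u).re| := by
  simp [abs_mul, abs_of_pos Real.pi_pos]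
  nlinarith [Real.pi_pos]

lemma cone_real {M : ℝ} {s : ℂ} (h : |s.im| ≤ M * |s.re|) (r : ℝ) :
    |(s * r).im| ≤ M * |(s * r).re| := by
  simp [abs_mul]
  nlinarith [abs_nonneg r]

lemma cosh_ne_cone {M : ℝ} (hM : 0 ≤ M) {u : ℂ} (h : |u.im| ≤ M * |u.re|) : Complex.cosh (π * u) ≠ 0 := by
  obtain ⟨c, hc, H⟩ := cosh_lower hM
  have := H _ (cone_pi h)
  intro h0
  rw [h0, norm_zero] at this
  have : 0 < c * Real.exp |((π : ℂ) * u).re| := by positivity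
  linarith

lemma f0_bound {M : ℝ} (hM : 0 ≤ M) : ∃ C : ℝ, 0 < C ∧ ∀ z : ℝ, 0 ≤ z → ∀ u : ℂ, |u.im| ≤ M * |u.re| →
    ‖f0 z u‖ ≤ C * Real.exp (-(π * (1 - 4 * z)) * |u.re|) := by
  obtain ⟨c, hc, H⟩ := cosh_lower hM
  refine ⟨1 / c, by positivity, fun z hz u hu => ?_⟩
  have h1 := H _ (cone_pi hu)
  have h2 : |((π : ℂ) * u).re| = π * |u.re| := by simp [abs_mul, abs_of_pos Real.pi_pos]
  rw [h2] at h1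
  have hpos : 0 < c * Real.exp (π * |u.re|) := by positivity
  rw [f0, norm_div, div_le_iff₀ (lt_of_lt_of_le hpos h1), Complex.norm_exp]
  calc Real.exp (-(4 * π * z) * u : ℂ).re ≤ Real.exp (4 * π * z * |u.re|) := by
        apply Real.exp_le_exp.mpr
        have : (-(4 * π * z) * u : ℂ).re = 4 * π * z * (-u.re) := by simp
        rw [this]
        have := neg_le_abs u.re
        have : 0 ≤ 4 * π * z := by positivity
        gcongr
    _ = 1 / c * Real.exp (-(π * (1 - 4 * z)) * |u.re|) * (c * Real.exp (π * |u.re|)) := by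
        rw [mul_mul_mul_comm, ← Real.exp_add]; field_simp; congr 1; ring
    _ ≤ _ := by gcongr

def f0d (z : ℝ) (u : ℂ) : ℂ :=
  f0 z u * (-(4 * π * z) - π * (Complex.sinh (π * u) / Complex.cosh (π * u)))

lemma f0_hasDerivAt (z : ℝ) {u : ℂ} (hu : Complex.cosh (π * u) ≠ 0) :
    HasDerivAt (f0 z) (f0d z u) u := by
  have h1 : HasDerivAt (fun u : ℂ => Complex.exp (-(4 * π * z) * u))
      (Complex.exp (-(4 * π * z) * u) * (-(4 * π * z))) u := by
    simpa using ((hasDerivAt_id u).const_mul (-(4 * π * z) : ℂ)).cexp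
  have h2 : HasDerivAt (fun u : ℂ => Complex.cosh (π * u)) (Complex.sinh (π * u) * π) u := by
    simpa using ((hasDerivAt_id u).const_mul (π : ℂ)).ccosh
  have h3 := h1.div h2 hu
  have h4 : f0d z u = (Complex.exp (-(4 * π * z) * u) * (-(4 * π * z)) * Complex.cosh (π * u) -
      Complex.exp (-(4 * π * z) * u) * (Complex.sinh (π * u) * π)) / Complex.cosh (π * u) ^ 2 := by
    simp only [f0d, f0]; field_simp
  rw [h4]; exact h3

lemma f0d_bound {M : ℝ} (hM : 0 ≤ M) : ∃ C : ℝ, 0 < C ∧ ∀ z : ℝ, 0 ≤ z → z < 1 / 4 → ∀ u : ℂ,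
    |u.im| ≤ M * |u.re| → ‖f0d z u‖ ≤ C * Real.exp (-(π * (1 - 4 * z)) * |u.re|) := by
  obtain ⟨c, hc, H⟩ := cosh_lower hM
  obtain ⟨C, hC, H'⟩ := f0_bound hM
  refine ⟨C * (π + π * (1 / c)), by positivity, fun z hz hz' u hu => ?_⟩
  have h1 := H _ (cone_pi hu)
  have h2 := norm_sinh_le ((π : ℂ) * u)
  have hpos : 0 < c * Real.exp |((π : ℂ) * u).re| := by positivity
  have h3 : ‖Complex.sinh (π * u) / Complex.cosh (π * u)‖ ≤ 1 / c := by
    rw [norm_div, div_le_iff₀ (hpos.trans_le h1)]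
    refine h2.trans ?_
    calc Real.exp |((π : ℂ) * u).re| = 1 / c * (c * Real.exp |((π : ℂ) * u).re|) := by field_simp
      _ ≤ _ := by gcongr
  have h4 : ‖(-(4 * π * z) - π * (Complex.sinh (π * u) / Complex.cosh (π * u)) : ℂ)‖ ≤ π + π * (1 / c) := by
    refine (norm_sub_le _ _).trans ?_
    rw [norm_mul]
    have : ‖(-(4 * π * z) : ℂ)‖ = 4 * π * z := by
      rw [norm_neg, show (4 * π * z : ℂ) = ((4 * π * z : ℝ) : ℂ) by push_cast; ring, Complex.norm_real,
        Real.norm_of_nonneg (by positivity)]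
    rw [this, Complex.norm_real, Real.norm_of_nonneg Real.pi_pos.le]
    have := Real.pi_pos
    gcongr
    nlinarith
  rw [f0d, norm_mul]
  calc _ ≤ (C * Real.exp (-(π * (1 - 4 * z)) * |u.re|)) * (π + π * (1 / c)) := by
        gcongr; exact H' z hz u hu
    _ = _ := by ring

lemma f0_cont {M : ℝ} (hM : 0 ≤ M) (z : ℝ) {s : ℂ} (hs : |s.im| ≤ M * |s.re|) :
    Continuous (fun r : ℝ => f0 z (s * r)) := by
  unfold f0
  apply Continuous.div
  · fun_prop
  · fun_prop
  · intro r; exact cosh_ne_cone hM (cone_real hs r)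

lemma f0d_cont {M : ℝ} (hM : 0 ≤ M) (z : ℝ) {s : ℂ} (hs : |s.im| ≤ M * |s.re|) :
    Continuous (fun r : ℝ => f0d z (s * r)) := by
  unfold f0d
  apply (f0_cont hM z hs).mul
  apply Continuous.sub continuous_const
  apply Continuous.mul continuous_const
  apply Continuous.div
  · fun_prop
  · fun_prop
  · intro r; exact cosh_ne_cone hM (cone_real hs r)

lemma abs_mul_exp_le {a : ℝ} (ha : 0 < a) (r : ℝ) :
    |r| * Real.exp (-a * |r|) ≤ 2 / a * Real.exp (-(a / 2) * |r|) := by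
  have h1 : a / 2 * |r| ≤ Real.exp (a / 2 * |r|) := by
    linarith [Real.add_one_le_exp (a / 2 * |r|)]
  have h2 : Real.exp (-(a / 2) * |r|) = Real.exp (-a * |r|) * Real.exp (a / 2 * |r|) := by
    rw [← Real.exp_add]; congr 1; ring
  rw [h2]
  have h3 : |r| ≤ 2 / a * Real.exp (a / 2 * |r|) := by
    rw [div_mul_eq_mul_div, le_div_iff₀ ha]; linarith
  nlinarith [Real.exp_pos (-a * |r|)]

def Jz (z : ℝ) : ℂ := ∫ x : ℝ, f0 z x

lemma rot_deriv {z : ℝ} (hz : 0 ≤ z) (hz' : z < 1 / 4) {s₀ : ℂ} (hs : 0 < s₀.re) :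
    HasDerivAt (fun s : ℂ => ∫ r : ℝ, s * f0 z (s * r)) 0 s₀ := by
  set c := s₀.re / 2 with hc
  have hc0 : 0 < c := by positivity
  set B := ‖s₀‖ + c with hB
  have hB0 : 0 < B := by positivity
  set M := B / c with hMd
  have hM : 0 ≤ M := by positivity
  have hk : 0 < π * (1 - 4 * z) := mul_pos Real.pi_pos (by linarith)
  have hball : ∀ s ∈ Metric.ball s₀ c, c ≤ s.re ∧ ‖s‖ ≤ B ∧ |s.im| ≤ M * |s.re| := by
    intro s hs'
    rw [Metric.mem_ball, dist_eq_norm] at hs'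
    have h1 : |(s - s₀).re| ≤ ‖s - s₀‖ := Complex.abs_re_le_norm _
    have h2 : c ≤ s.re := by
      rw [Complex.sub_re, abs_le] at h1
      have : s₀.re = 2 * c := by rw [hc]; ring
      linarith [h1.1]
    have h3 : ‖s‖ ≤ B := by
      have := norm_add_le (s - s₀) s₀
      rw [sub_add_cancel] at this; linarith
    refine ⟨h2, h3, ?_⟩
    calc |s.im| ≤ ‖s‖ := Complex.abs_im_le_norm _
      _ ≤ B := h3
      _ = M * c := by rw [hMd]; field_simp
      _ ≤ M * |s.re| := by gcongr; exact h2.trans (le_abs_self _)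
  have hs₀ := hball s₀ (Metric.mem_ball_self hc0)
  obtain ⟨C, hC, H⟩ := f0_bound hM
  obtain ⟨D, hD, H'⟩ := f0d_bound hM
  set a := π * (1 - 4 * z) * c with ha
  have ha0 : 0 < a := by positivity
  have hexp : ∀ s ∈ Metric.ball s₀ c, ∀ r : ℝ,
      Real.exp (-(π * (1 - 4 * z)) * |(s * r).re|) ≤ Real.exp (-a * |r|) := by
    intro s hs' r
    apply Real.exp_le_exp.mpr
    rw [Complex.re_mul_ofReal, abs_mul, ha]
    have h1 := (hball s hs').1.trans (le_abs_self _)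
    have : π * (1 - 4 * z) * (c * |r|) ≤ π * (1 - 4 * z) * (|s.re| * |r|) := by gcongr
    linarith
  have b1 : ∀ s ∈ Metric.ball s₀ c, ∀ r : ℝ, ‖f0 z (s * r)‖ ≤ C * Real.exp (-a * |r|) := by
    intro s hs' r
    refine (H z hz _ (cone_real (hball s hs').2.2 r)).trans ?_
    exact mul_le_mul_of_nonneg_left (hexp s hs' r) hC.le
  have b2 : ∀ s ∈ Metric.ball s₀ c, ∀ r : ℝ, ‖f0d z (s * r)‖ ≤ D * Real.exp (-a * |r|) := by
    intro s hs' r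
    refine (H' z hz hz' _ (cone_real (hball s hs').2.2 r)).trans ?_
    exact mul_le_mul_of_nonneg_left (hexp s hs' r) hD.le
  have hbi : ∀ K : ℝ, MeasureTheory.Integrable (fun r : ℝ => K * Real.exp (-(a / 2) * |r|)) := fun K =>
    (integrable_exp_neg_abs' (half_pos ha0)).const_mul K
  have hle : ∀ r : ℝ, Real.exp (-a * |r|) ≤ Real.exp (-(a / 2) * |r|) := by
    intro r; apply Real.exp_le_exp.mpr; nlinarith [abs_nonneg r]
  have key := hasDerivAt_integral_of_dominated_loc_of_deriv_le (μ := MeasureTheory.volume)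
    (F := fun (s : ℂ) (r : ℝ) => s * f0 z (s * r))
    (F' := fun (s : ℂ) (r : ℝ) => f0 z (s * r) + s * (f0d z (s * r) * r)) (x₀ := s₀)
    (bound := fun r => (C + B * D * (2 / a)) * Real.exp (-(a / 2) * |r|))
    (Metric.ball_mem_nhds s₀ hc0)
    (by
      filter_upwards [Metric.ball_mem_nhds s₀ hc0] with s hs'
      exact (continuous_const.mul (f0_cont hM z (hball s hs').2.2)).aestronglyMeasurable)
    (by
      refine MeasureTheory.Integrable.mono' (hbi (B * C))
        (continuous_const.mul (f0_cont hM z hs₀.2.2)).aestronglyMeasurable (.of_forall fun r => ?_)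
      rw [norm_mul, mul_assoc]
      gcongr
      · exact hs₀.2.1
      · refine (b1 s₀ (Metric.mem_ball_self hc0) r).trans ?_
        exact mul_le_mul_of_nonneg_left (hle r) hC.le)
    (by
      apply Continuous.aestronglyMeasurable
      exact (f0_cont hM z hs₀.2.2).add (continuous_const.mul ((f0d_cont hM z hs₀.2.2).mul (by fun_prop))))
    (.of_forall fun r s hs' => by
      refine (norm_add_le _ _).trans ?_
      rw [add_mul]
      gcongr
      · refine (b1 s hs' r).trans ?_
        exact mul_le_mul_of_nonneg_left (hle r) hC.le
      · rw [norm_mul, norm_mul, Complex.norm_real, Real.norm_eq_abs]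
        calc _ ≤ B * (D * Real.exp (-a * |r|) * |r|) := by
              gcongr
              · exact (hball s hs').2.1
              · exact b2 s hs' r
          _ = B * D * (|r| * Real.exp (-a * |r|)) := by ring
          _ ≤ B * D * (2 / a * Real.exp (-(a / 2) * |r|)) := by gcongr B * D * ?_; exact abs_mul_exp_le ha0 r
          _ = _ := by ring)
    (hbi _)
    (.of_forall fun r s hs' => by
      have h1 := f0_hasDerivAt z (cosh_ne_cone hM (cone_real (hball s hs').2.2 r))
      have h2 : HasDerivAt (fun s : ℂ => s * (r : ℂ)) (r : ℂ) s := by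
        simpa using (hasDerivAt_id s).mul_const (r : ℂ)
      have h3 := (hasDerivAt_id s).mul (h1.comp s h2)
      exact h3.congr_deriv (by simp))
  have hzero : ∫ r : ℝ, (f0 z (s₀ * r) + s₀ * (f0d z (s₀ * r) * r)) = 0 := by
    have hlim : ∀ l : Filter ℝ, Tendsto (fun r : ℝ => |r|) l atTop →
        Tendsto (fun r : ℝ => (r : ℂ) * f0 z (s₀ * r)) l (𝓝 0) := by
      intro l hl
      have h0 : Tendsto (fun r : ℝ => C * (2 / a * Real.exp (-(a / 2) * |r|))) l (𝓝 0) := by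
        have : Tendsto (fun r : ℝ => -(a / 2) * |r|) l atBot :=
          hl.const_mul_atTop_of_neg (by linarith)
        have := (Real.tendsto_exp_atBot.comp this).const_mul (2 / a) |>.const_mul C
        simpa using this
      refine squeeze_zero_norm (fun r => ?_) h0
      rw [norm_mul, Complex.norm_real, Real.norm_eq_abs]
      calc _ ≤ |r| * (C * Real.exp (-a * |r|)) := by
            gcongr; exact b1 s₀ (Metric.mem_ball_self hc0) r
        _ = C * (|r| * Real.exp (-a * |r|)) := by ring
        _ ≤ _ := by gcongr C * ?_; exact abs_mul_exp_le ha0 r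
    have := MeasureTheory.integral_of_hasDerivAt_of_tendsto
      (f := fun r : ℝ => (r : ℂ) * f0 z (s₀ * r))
      (f' := fun r : ℝ => f0 z (s₀ * r) + s₀ * (f0d z (s₀ * r) * r))
      (fun r => by
        have h1 := f0_hasDerivAt z (cosh_ne_cone hM (cone_real hs₀.2.2 r))
        have h2 : HasDerivAt (fun r : ℝ => s₀ * (r : ℂ)) s₀ r := by
          simpa using (Complex.ofRealCLM.hasDerivAt (x := r)).const_mul s₀
        have h3 : HasDerivAt (fun r : ℝ => (r : ℂ)) 1 r := by
          exact (hasDerivAt_id r).ofReal_comp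
        have h4 := h3.mul (h1.comp r h2)
        exact h4.congr_deriv (by simp; ring))
      key.1 (hlim _ tendsto_abs_atBot_atTop) (hlim _ tendsto_abs_atTop_atTop)
    rw [this, sub_zero]
  have := key.2
  rw [hzero] at this
  exact this

lemma rot {z : ℝ} (hz : 0 ≤ z) (hz' : z < 1 / 4) {s : ℂ} (hs : 0 < s.re) :
    ∫ r : ℝ, s * f0 z (s * r) = Jz z := by
  have hconv : Convex ℝ {s : ℂ | 0 < s.re} := convex_halfSpace_re_gt 0
  have hopen : IsOpen {s : ℂ | 0 < s.re} := isOpen_lt continuous_const Complex.continuous_re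
  have := hopen.is_const_of_deriv_eq_zero (f := fun s : ℂ => ∫ r : ℝ, s * f0 z (s * r))
    hconv.isPreconnected
    (fun x hx => (rot_deriv hz hz' hx).differentiableAt.differentiableWithinAt)
    (fun x hx => (rot_deriv hz hz' hx).deriv) hs (show (1 : ℂ) ∈ {s : ℂ | 0 < s.re} by simp)
  rw [this, Jz]; simp

def cone (M : ℝ) : Set ℂ := {t : ℂ | 0 < t.re ∧ |t.im| ≤ M * t.re}

def Lam (t : ℂ) : ℂ := π / (2 * t)

def sdir (t : ℂ) : ℂ := ‖t‖ / t

lemma cone_ne {M : ℝ} {t : ℂ} (ht : t ∈ cone M) : t ≠ 0 := by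
  intro h; have := ht.1; simp [h] at this

lemma cone_norm_le {M : ℝ} {t : ℂ} (ht : t ∈ cone M) : ‖t‖ ≤ (1 + M) * t.re := by
  have := Complex.norm_le_abs_re_add_abs_im t
  rw [abs_of_pos ht.1] at this
  linarith [ht.2]

lemma inv_cone {M : ℝ} {t : ℂ} (ht : t ∈ cone M) : t⁻¹ ∈ cone M := by
  have h0 : 0 < Complex.normSq t := Complex.normSq_pos.mpr (cone_ne ht)
  refine ⟨?_, ?_⟩
  · rw [Complex.inv_re]; exact div_pos ht.1 h0
  · rw [Complex.inv_re, Complex.inv_im, abs_div, abs_neg, abs_of_pos h0, ← mul_div_assoc]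
    gcongr; exact ht.2

lemma smul_cone {M : ℝ} {t : ℂ} (ht : t ∈ cone M) {c : ℝ} (hc : 0 < c) : (c : ℂ) * t ∈ cone M := by
  refine ⟨?_, ?_⟩
  · rw [Complex.re_ofReal_mul]; exact mul_pos hc ht.1
  · rw [Complex.re_ofReal_mul, Complex.im_ofReal_mul, abs_mul, abs_of_pos hc]
    nlinarith [ht.2]

lemma cone_abs {M : ℝ} {t : ℂ} (ht : t ∈ cone M) : |t.im| ≤ M * |t.re| := by
  rw [abs_of_pos ht.1]; exact ht.2

lemma sdir_cone {M : ℝ} {t : ℂ} (ht : t ∈ cone M) : sdir t ∈ cone M := by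
  rw [sdir, div_eq_mul_inv]
  exact smul_cone (inv_cone ht) (norm_pos_iff.mpr (cone_ne ht))

lemma norm_sdir {M : ℝ} {t : ℂ} (ht : t ∈ cone M) : ‖sdir t‖ = 1 := by
  have := norm_pos_iff.mpr (cone_ne ht)
  rw [sdir, norm_div, Complex.norm_real, norm_norm, div_self this.ne']

lemma sdir_re {M : ℝ} (hM : 0 ≤ M) {t : ℂ} (ht : t ∈ cone M) : 1 / (1 + M) ≤ (sdir t).re := by
  have := cone_norm_le (sdir_cone ht)
  rw [norm_sdir ht] at this
  rw [div_le_iff₀ (by linarith)]; linarith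

lemma Lam_eq {M : ℝ} {t : ℂ} (ht : t ∈ cone M) : Lam t = ((π / (2 * ‖t‖) : ℝ) : ℂ) * sdir t := by
  have h1 := cone_ne ht
  have h2 : (‖t‖ : ℂ) ≠ 0 := by exact_mod_cast (norm_pos_iff.mpr h1).ne'
  rw [Lam, sdir]; push_cast; field_simp

lemma tendsto_lamR (M : ℝ) : Tendsto (fun t : ℂ => π / (2 * ‖t‖)) (𝓝[cone M] 0) atTop := by
  have h1 : Tendsto (fun t : ℂ => ‖t‖) (𝓝[cone M] 0) (𝓝[>] 0) := by
    rw [tendsto_nhdsWithin_iff]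
    constructor
    · exact (tendsto_norm_zero (E := ℂ)).mono_left nhdsWithin_le_nhds
    · filter_upwards [self_mem_nhdsWithin] with t ht
      exact norm_pos_iff.mpr (cone_ne ht)
  have h2 := (tendsto_inv_nhdsGT_zero.comp h1).const_mul_atTop (show 0 < π / 2 by positivity)
  refine h2.congr fun t => ?_
  simp only [Function.comp]; rw [div_mul_eq_div_div, div_eq_mul_inv _ ‖t‖]

lemma limK {M : ℝ} (hM : 0 ≤ M) {z : ℝ} (hz : 0 ≤ z) (hz' : z < 1 / 4) {b : ℝ} (hb : 0 ≤ b) :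
    Tendsto (fun t : ℂ => Lam t * ∫ r in (-1 : ℝ)..1,
      Complex.exp (-b * t * (Lam t * r) ^ 2) * f0 z (Lam t * r)) (𝓝[cone M] 0) (𝓝 (Jz z)) := by
  obtain ⟨C, hC, H⟩ := f0_bound hM
  set a := π * (1 - 4 * z) / (1 + M) with ha
  have hk : 0 < π * (1 - 4 * z) := mul_pos Real.pi_pos (by linarith)
  have ha0 : 0 < a := by positivity
  have hf : ∀ t ∈ cone M, ∀ r : ℝ, ‖f0 z (sdir t * r)‖ ≤ C * Real.exp (-a * |r|) := by
    intro t ht r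
    refine (H z hz _ (cone_real (cone_abs (sdir_cone ht)) r)).trans ?_
    refine mul_le_mul_of_nonneg_left (Real.exp_le_exp.mpr ?_) hC.le
    rw [Complex.re_mul_ofReal, abs_mul, ha]
    have h1 := (sdir_re hM ht).trans (le_abs_self _)
    have : π * (1 - 4 * z) * (1 / (1 + M) * |r|) ≤ π * (1 - 4 * z) * (|(sdir t).re| * |r|) := by gcongr
    calc _ = -(π * (1 - 4 * z) * (|(sdir t).re| * |r|)) := by ring
      _ ≤ -(π * (1 - 4 * z) * (1 / (1 + M) * |r|)) := by linarith
      _ = _ := by ring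
  set lam : ℂ → ℝ := fun t => π / (2 * ‖t‖) with hlam
  set g : ℂ → ℝ → ℂ := fun t r => Complex.exp (-b * t * (sdir t * r) ^ 2) with hg
  have hts : ∀ t ∈ cone M, ∀ r : ℝ, -b * t * (sdir t * r) ^ 2 = ((-b * ‖t‖ * r ^ 2 : ℝ) : ℂ) * sdir t := by
    intro t ht r
    have h1 := cone_ne ht
    rw [sdir]; push_cast; field_simp
  have hg1 : ∀ t ∈ cone M, ∀ r : ℝ, ‖g t r‖ ≤ 1 := by
    intro t ht r
    simp only [hg]
    rw [hts t ht, Complex.norm_exp, Complex.re_ofReal_mul, Real.exp_le_one_iff]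
    have : 0 ≤ b * ‖t‖ * r ^ 2 * (sdir t).re := by
      have := (sdir_cone ht).1
      positivity
    linarith
  set h : ℂ → ℝ → ℂ := fun t r => (Set.Ioc (-lam t) (lam t)).indicator
    (fun r : ℝ => sdir t * (g t r * f0 z (sdir t * r))) r - sdir t * f0 z (sdir t * r) with hh
  have hcont : ∀ t ∈ cone M, Continuous (fun r : ℝ => f0 z (sdir t * r)) := fun t ht =>
    f0_cont hM z (cone_abs (sdir_cone ht))
  have hcont2 : ∀ t ∈ cone M, Continuous (fun r : ℝ => sdir t * (g t r * f0 z (sdir t * r))) := fun t ht =>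
    continuous_const.mul (Continuous.mul (by simp only [hg]; fun_prop) (hcont t ht))
  have hint1 : ∀ t ∈ cone M, MeasureTheory.Integrable (fun r : ℝ => sdir t * f0 z (sdir t * r)) := by
    intro t ht
    refine MeasureTheory.Integrable.mono' ((integrable_exp_neg_abs' ha0).const_mul C)
      (continuous_const.mul (hcont t ht)).aestronglyMeasurable (.of_forall fun r => ?_)
    rw [norm_mul, norm_sdir ht, one_mul]; exact hf t ht r
  have hb2 : ∀ t ∈ cone M, ∀ r : ℝ, ‖sdir t * (g t r * f0 z (sdir t * r))‖ ≤ C * Real.exp (-a * |r|) := by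
    intro t ht r
    rw [norm_mul, norm_sdir ht, one_mul, norm_mul]
    calc _ ≤ 1 * (C * Real.exp (-a * |r|)) := by
          apply mul_le_mul (hg1 t ht r) (hf t ht r) (norm_nonneg _) zero_le_one
      _ = _ := one_mul _
  have hint2 : ∀ t ∈ cone M, MeasureTheory.Integrable (fun r : ℝ => sdir t * (g t r * f0 z (sdir t * r))) := by
    intro t ht
    exact MeasureTheory.Integrable.mono' ((integrable_exp_neg_abs' ha0).const_mul C)
      (hcont2 t ht).aestronglyMeasurable (.of_forall fun r => hb2 t ht r)
  have hlim : Tendsto (fun t => ∫ r, h t r) (𝓝[cone M] 0) (𝓝 (∫ r : ℝ, (0 : ℂ))) := by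
    apply MeasureTheory.tendsto_integral_filter_of_dominated_convergence
      (fun r => 2 * (C * Real.exp (-a * |r|)))
    · filter_upwards [self_mem_nhdsWithin] with t ht
      exact ((hint2 t ht).indicator measurableSet_Ioc).sub (hint1 t ht) |>.aestronglyMeasurable
    · filter_upwards [self_mem_nhdsWithin] with t ht
      refine .of_forall fun r => ?_
      simp only [hh]
      refine (norm_sub_le _ _).trans ?_
      rw [two_mul]
      apply add_le_add
      · exact (norm_indicator_le_norm_self _ _).trans (hb2 t ht r)
      · rw [norm_mul, norm_sdir ht, one_mul]; exact hf t ht r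
    · exact ((integrable_exp_neg_abs' ha0).const_mul C).const_mul 2
    · refine .of_forall fun r => ?_
      have e1 : Tendsto (fun t : ℂ => ‖Complex.exp (-b * t * (sdir t * r) ^ 2) - 1‖ * C) (𝓝[cone M] 0) (𝓝 0) := by
        have : Tendsto (fun t : ℂ => -b * t * (sdir t * r) ^ 2) (𝓝[cone M] 0) (𝓝 0) := by
          have e2 : Tendsto (fun t : ℂ => b * ‖t‖ * r ^ 2) (𝓝[cone M] 0) (𝓝 0) := by
            have := ((tendsto_norm_zero (E := ℂ)).mono_left
              (nhdsWithin_le_nhds (s := cone M))).const_mul b |>.mul_const (r ^ 2)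
            simpa using this
          refine squeeze_zero_norm' ?_ e2
          filter_upwards [self_mem_nhdsWithin] with t ht
          rw [norm_mul, norm_mul, norm_pow, norm_mul, norm_sdir ht]
          simp [abs_of_nonneg hb]
        have := (((Complex.continuous_exp.tendsto 0).comp this).sub_const 1).norm.mul_const C
        simpa using this
      refine squeeze_zero_norm' ?_ e1
      filter_upwards [self_mem_nhdsWithin, (tendsto_lamR M).eventually_gt_atTop |r|] with t ht hr
      have hm : r ∈ Set.Ioc (-lam t) (lam t) := by
        rw [abs_lt] at hr; exact ⟨hr.1, hr.2.le⟩
      simp only [hh]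
      rw [Set.indicator_of_mem hm, ← mul_sub, norm_mul, norm_sdir ht, one_mul]
      rw [show g t r * f0 z (sdir t * r) - f0 z (sdir t * r) = (g t r - 1) * f0 z (sdir t * r) by ring, norm_mul]
      refine mul_le_mul_of_nonneg_left ((hf t ht r).trans ?_) (norm_nonneg _)
      have : Real.exp (-a * |r|) ≤ 1 := by
        rw [Real.exp_le_one_iff]; nlinarith [abs_nonneg r]
      nlinarith
  rw [MeasureTheory.integral_zero] at hlim
  have hfin := hlim.add_const (Jz z)
  rw [zero_add] at hfin
  refine hfin.congr' ?_
  filter_upwards [self_mem_nhdsWithin] with t ht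
  simp only [hh]
  rw [MeasureTheory.integral_sub ((hint2 t ht).indicator measurableSet_Ioc) (hint1 t ht),
    rot hz hz' (sdir_cone ht).1, sub_add_cancel, MeasureTheory.integral_indicator measurableSet_Ioc]
  have hl0 : 0 < lam t := by
    have := norm_pos_iff.mpr (cone_ne ht)
    simp only [hlam]; positivity
  rw [← intervalIntegral.integral_of_le (by linarith)]
  have hsub := intervalIntegral.smul_integral_comp_mul_left (a := -1) (b := 1)
    (fun r : ℝ => sdir t * (g t r * f0 z (sdir t * r))) (lam t)
  rw [mul_neg_one, mul_one] at hsub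
  rw [← hsub, intervalIntegral.integral_const_mul, Complex.real_smul, Lam_eq ht, ← mul_assoc]
  congr 1
  apply intervalIntegral.integral_congr
  intro r _
  have : sdir t * ((lam t * r : ℝ) : ℂ) = (lam t : ℂ) * sdir t * r := by push_cast; ring
  simp only [hg]
  rw [this]

lemma f0_real_int {z : ℝ} (hz : 0 ≤ z) (hz' : z < 1 / 4) : MeasureTheory.Integrable (fun x : ℝ => f0 z x) := by
  obtain ⟨C, hC, H⟩ := f0_bound (le_refl (0:ℝ))
  have hc : Continuous (fun x : ℝ => f0 z x) := by
    have := f0_cont (le_refl (0:ℝ)) z (s := 1) (by simp)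
    simpa using this
  have hk : 0 < π * (1 - 4 * z) := mul_pos Real.pi_pos (by linarith)
  refine MeasureTheory.Integrable.mono' ((integrable_exp_neg_abs' hk).const_mul C)
    hc.aestronglyMeasurable (.of_forall fun r => ?_)
  have := H z hz (r : ℂ) (by simp)
  simpa using this

lemma f0_ofReal (z x : ℝ) : f0 z x = ((Real.exp (-(4 * π * z) * x) / Real.cosh (π * x) : ℝ) : ℂ) := by
  rw [f0]; push_cast; rfl

lemma Jz_ne {z : ℝ} (hz : 0 ≤ z) (hz' : z < 1 / 4) : Jz z ≠ 0 := by
  have h1 := f0_real_int hz hz'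
  simp only [f0_ofReal] at h1
  have h2 : MeasureTheory.Integrable (fun x : ℝ => Real.exp (-(4 * π * z) * x) / Real.cosh (π * x)) := by
    exact h1.re
  have h3 : Jz z = ((∫ x : ℝ, Real.exp (-(4 * π * z) * x) / Real.cosh (π * x) : ℝ) : ℂ) := by
    rw [Jz]; simp only [f0_ofReal]; exact integral_ofReal
  rw [h3]
  have hpos : ∀ x : ℝ, 0 < Real.exp (-(4 * π * z) * x) / Real.cosh (π * x) := fun x =>
    div_pos (Real.exp_pos _) (Real.cosh_pos _)
  have : 0 < ∫ x : ℝ, Real.exp (-(4 * π * z) * x) / Real.cosh (π * x) := by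
    rw [MeasureTheory.integral_pos_iff_support_of_nonneg (fun x => (hpos x).le) h2]
    have : Function.support (fun x : ℝ => Real.exp (-(4 * π * z) * x) / Real.cosh (π * x)) = Set.univ := by
      ext x; simpa using (hpos x).ne'
    rw [this]; simp
  exact_mod_cast this.ne'

lemma Jz_zero : Jz 0 = 1 := by
  have h1 := f0_real_int (le_refl 0) (by norm_num)
  have hpi := Real.pi_pos
  have hd : ∀ x : ℝ, HasDerivAt (fun x : ℝ => ((2 / π * Real.arctan (Real.exp (π * x)) : ℝ) : ℂ)) (f0 0 x) x := by
    intro x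
    have e1 : HasDerivAt (fun x : ℝ => Real.exp (π * x)) (Real.exp (π * x) * π) x := by
      simpa using ((hasDerivAt_id x).const_mul π).exp
    have e2 := ((e1.arctan).const_mul (2 / π)).ofReal_comp
    refine e2.congr_deriv ?_
    rw [f0_ofReal]
    congr 1
    rw [Real.cosh_eq, Real.exp_neg]
    have := Real.exp_pos (π * x)
    field_simp
    simp
    ring
  have ht : Tendsto (fun x : ℝ => ((2 / π * Real.arctan (Real.exp (π * x)) : ℝ) : ℂ)) atTop (𝓝 1) := by
    have e : Tendsto (fun x : ℝ => 2 / π * Real.arctan (Real.exp (π * x))) atTop (𝓝 (2 / π * (π / 2))) := by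
      apply Tendsto.const_mul
      have := (Real.tendsto_arctan_atTop.mono_right nhdsWithin_le_nhds).comp
        (Real.tendsto_exp_atTop.comp (tendsto_id.const_mul_atTop hpi))
      exact this
    have e' := (Complex.continuous_ofReal.tendsto _).comp e
    rw [show 2 / π * (π / 2) = 1 by field_simp, Complex.ofReal_one] at e'
    exact e'
  have hb : Tendsto (fun x : ℝ => ((2 / π * Real.arctan (Real.exp (π * x)) : ℝ) : ℂ)) atBot (𝓝 0) := by
    have e : Tendsto (fun x : ℝ => 2 / π * Real.arctan (Real.exp (π * x))) atBot (𝓝 (2 / π * 0)) := by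
      apply Tendsto.const_mul
      have := (Real.continuous_arctan.tendsto 0).comp
        (Real.tendsto_exp_atBot.comp (tendsto_id.const_mul_atBot hpi))
      rw [Real.arctan_zero] at this
      exact this
    have e' := (Complex.continuous_ofReal.tendsto _).comp e
    rw [mul_zero, Complex.ofReal_zero] at e'
    exact e'
  rw [Jz, MeasureTheory.integral_of_hasDerivAt_of_tendsto hd h1 hb ht, sub_zero]

lemma lim_mordell (M : ℝ) {z : ℝ} (hz : 0 ≤ z) (hz' : z < 1 / 4) :
    Tendsto (fun t : ℂ => ∫ x : ℝ, Complex.exp (-t * (x : ℂ) ^ 2) * f0 z x) (𝓝[cone M] 0) (𝓝 (Jz z)) := by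
  have h1 := f0_real_int hz hz'
  apply MeasureTheory.tendsto_integral_filter_of_dominated_convergence (fun x : ℝ => ‖f0 z x‖)
  · filter_upwards with t
    exact (Continuous.aestronglyMeasurable (by fun_prop)).mul h1.aestronglyMeasurable
  · filter_upwards [self_mem_nhdsWithin] with t ht
    refine .of_forall fun x => ?_
    rw [norm_mul]
    apply mul_le_of_le_one_left (norm_nonneg _)
    rw [Complex.norm_exp, Real.exp_le_one_iff, ← Complex.ofReal_pow, Complex.re_mul_ofReal, Complex.neg_re]
    nlinarith [ht.1, sq_nonneg x]
  · exact h1.norm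
  · refine .of_forall fun x => ?_
    have : Tendsto (fun t : ℂ => Complex.exp (-t * (x : ℂ) ^ 2) * f0 z x) (𝓝 0)
        (𝓝 (Complex.exp (-0 * (x : ℂ) ^ 2) * f0 z x)) := by
      apply Continuous.tendsto; fun_prop
    simpa using this.mono_left nhdsWithin_le_nhds

lemma contour_shift (L : ℂ) (χ : ℂ → ℂ)
    (hχ : ∀ r ∈ Set.Icc (-1 : ℝ) 1, ∀ a ∈ Set.Icc (0 : ℝ) (1 / 2), DifferentiableAt ℂ χ (L * r + I * a)) :
    (∫ r in (-1 : ℝ)..1, L * χ (L * r + I * ((1 / 2 : ℝ) : ℂ))) - (∫ r in (-1 : ℝ)..1, L * χ (L * r + I * ((0 : ℝ) : ℂ)))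
      = (∫ a in (0 : ℝ)..(1 / 2), -I * χ (L * ((-1 : ℝ) : ℂ) + I * a)) -
        ∫ a in (0 : ℝ)..(1 / 2), -I * χ (L * ((1 : ℝ) : ℂ) + I * a) := by
  set A : ℝ × ℝ →L[ℝ] ℂ := L • (Complex.ofRealCLM.comp (ContinuousLinearMap.fst ℝ ℝ ℝ)) +
    I • (Complex.ofRealCLM.comp (ContinuousLinearMap.snd ℝ ℝ ℝ)) with hA
  have hAv : ∀ x : ℝ × ℝ, A x = L * x.1 + I * x.2 := by intro x; simp [hA]
  set D : ℝ × ℝ → ℝ × ℝ →L[ℝ] ℂ := fun x => (deriv χ (A x)) • A with hD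
  have hd : ∀ x : ℝ × ℝ, x ∈ Set.Icc (-1 : ℝ) 1 ×ˢ Set.Icc (0 : ℝ) (1 / 2) →
      HasFDerivAt (fun x => χ (A x)) (D x) x := by
    intro x hx
    have h1 : HasDerivAt χ (deriv χ (A x)) (A x) := by
      rw [hAv]; exact (hχ x.1 hx.1 x.2 hx.2).hasDerivAt
    have h2 := (h1.hasFDerivAt.restrictScalars ℝ).comp x A.hasFDerivAt
    refine h2.congr_fderiv ?_
    ext v <;> simp [hD, mul_comm]
  have hsub : Set.Ioo (min (-1 : ℝ) 1) (max (-1) 1) ×ˢ Set.Ioo (min (0 : ℝ) (1 / 2)) (max 0 (1 / 2)) ⊆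
      Set.Icc (-1 : ℝ) 1 ×ˢ Set.Icc (0 : ℝ) (1 / 2) := by
    apply Set.prod_mono
    · rw [min_eq_left (by norm_num), max_eq_right (by norm_num)]; exact Set.Ioo_subset_Icc_self
    · rw [min_eq_left (by norm_num), max_eq_right (by norm_num)]; exact Set.Ioo_subset_Icc_self
  have hu1 : Set.uIcc (-1 : ℝ) 1 = Set.Icc (-1) 1 := Set.uIcc_of_le (by norm_num)
  have hu2 : Set.uIcc (0 : ℝ) (1 / 2) = Set.Icc 0 (1 / 2) := Set.uIcc_of_le (by norm_num)
  have hz : ∀ x : ℝ × ℝ, ((-I) • D x) (1, 0) + (L • D x) (0, 1) = 0 := by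
    intro x
    simp [hD, hA]; ring
  have key := MeasureTheory.integral2_divergence_prod_of_hasFDerivAt_off_countable
    (fun x => -I * χ (A x)) (fun x => L * χ (A x)) (fun x => (-I) • D x) (fun x => L • D x)
    (-1) 0 1 (1 / 2) ∅ Set.countable_empty
    (by
      rw [hu1, hu2]
      exact fun x hx => ((hd x hx).continuousAt.const_mul (-I)).continuousWithinAt)
    (by
      rw [hu1, hu2]
      exact fun x hx => ((hd x hx).continuousAt.const_mul L).continuousWithinAt)
    (fun x hx => (hd x (hsub hx.1)).const_mul (-I))
    (fun x hx => (hd x (hsub hx.1)).const_mul L)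
    (by simp only [hz]; exact MeasureTheory.integrableOn_zero)
  simp only [hz, intervalIntegral.integral_zero] at key
  simp only [hAv] at key
  linear_combination -key

def mfun (t : ℂ) (Y : ℝ) (v : ℂ) : ℂ := Complex.exp (t * v ^ 2) * Complex.cos (2 * t * Y * v)

def chi (t : ℂ) (Y : ℝ) (v : ℂ) : ℂ :=
  dslope (mfun t Y) 0 v / dslope (fun v => -I * Complex.sinh (π * v)) 0 v

lemma chi_of_ne (t : ℂ) (Y : ℝ) {v : ℂ} (hv : v ≠ 0) :
    chi t Y v = (mfun t Y v - 1) / (-I * Complex.sinh (π * v)) := by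
  rw [chi, dslope_of_ne _ hv, dslope_of_ne _ hv, slope_def_field, slope_def_field]
  simp [mfun]
  field_simp

lemma mfun_diff (t : ℂ) (Y : ℝ) : Differentiable ℂ (mfun t Y) := by
  unfold mfun; fun_prop

lemma chi_zero (t : ℂ) (Y : ℝ) : chi t Y 0 = 0 := by
  have h : HasDerivAt (mfun t Y) 0 0 := by
    have h1 : HasDerivAt (fun v : ℂ => Complex.exp (t * v ^ 2)) 0 0 := by
      have := (((hasDerivAt_id (0 : ℂ)).pow 2).const_mul t).cexp
      simpa using this
    have h2 : HasDerivAt (fun v : ℂ => Complex.cos (2 * t * Y * v)) 0 0 := by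
      have := ((hasDerivAt_id (0 : ℂ)).const_mul (2 * t * Y)).ccos
      simpa using this
    exact (h1.mul h2).congr_deriv (by simp)
  rw [chi, dslope_same, h.deriv, zero_div]

lemma chi_odd (t : ℂ) (Y : ℝ) (v : ℂ) : chi t Y (-v) = -chi t Y v := by
  rcases eq_or_ne v 0 with h | h
  · simp [h, chi_zero]
  · rw [chi_of_ne _ _ h, chi_of_ne _ _ (neg_ne_zero.mpr h)]
    simp [mfun, Complex.sinh_neg, div_neg, neg_div]

lemma chi_diff (t : ℂ) (Y : ℝ) {v : ℂ} (hv : v = 0 ∨ Complex.sinh (π * v) ≠ 0) :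
    DifferentiableAt ℂ (chi t Y) v := by
  have h1 : ∀ f : ℂ → ℂ, Differentiable ℂ f → Differentiable ℂ (dslope f 0) := by
    intro f hf
    rw [← differentiableOn_univ]
    exact (Complex.differentiableOn_dslope univ_mem).mpr hf.differentiableOn
  have hs : HasDerivAt (fun v : ℂ => -I * Complex.sinh (π * v)) (-I * π) 0 := by
    have := (((hasDerivAt_id (0 : ℂ)).const_mul (π : ℂ)).csinh).const_mul (-I)
    simpa using this
  apply DifferentiableAt.div
  · exact h1 _ (mfun_diff t Y) v
  · exact h1 _ (by fun_prop) v
  · rcases hv with h | h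
    · rw [h, dslope_same, hs.deriv]; simp [Real.pi_ne_zero]
    · have hv0 : v ≠ 0 := by rintro rfl; simp at h
      rw [dslope_of_ne _ hv0, slope_def_field]
      simp [h, hv0]

def Et (t : ℂ) (y : ℝ) : ℂ :=
  1 / 2 * Lam t * ∫ r in (-1 : ℝ)..1, Complex.exp (t * (Lam t * r + I * y) ^ 2) / Complex.cosh (π * (Lam t * r))

def Q0 (t : ℂ) : ℂ := Lam t * ∫ r in (-1 : ℝ)..1, f0 0 (Lam t * r)

lemma Et_even (t : ℂ) (y : ℝ) : Et t (-y) = Et t y := by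
  rw [Et, Et]
  congr 1
  have := intervalIntegral.integral_comp_neg (a := -1) (b := 1)
    (fun r : ℝ => Complex.exp (t * (Lam t * r + I * y) ^ 2) / Complex.cosh (π * (Lam t * r)))
  rw [neg_neg] at this
  rw [← this]
  apply intervalIntegral.integral_congr
  intro r _
  simp only
  rw [show (π * (Lam t * ((-r : ℝ) : ℂ)) : ℂ) = -(π * (Lam t * r)) by push_cast; ring, Complex.cosh_neg]
  congr 2; push_cast; ring

lemma Lam_cone {M : ℝ} {t : ℂ} (ht : t ∈ cone M) : Lam t ∈ cone M := by
  have : Lam t = ((π / 2 : ℝ) : ℂ) * t⁻¹ := by rw [Lam]; push_cast; field_simp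
  rw [this]; exact smul_cone (inv_cone ht) (by positivity)

lemma Lam_re (t : ℂ) : (Lam t).re = π / 2 * (t⁻¹).re := by
  have : Lam t = ((π / 2 : ℝ) : ℂ) * t⁻¹ := by rw [Lam]; push_cast; field_simp
  rw [this, Complex.re_ofReal_mul]

lemma sinh_ne_strip {L : ℂ} (hL : 0 < L.re) (r a : ℝ) (ha : a ∈ Set.Icc (0 : ℝ) (1 / 2)) :
    L * r + I * a = 0 ∨ Complex.sinh (π * (L * r + I * a)) ≠ 0 := by
  by_contra! h
  obtain ⟨h1, h2⟩ := h
  have h3 := norm_sinh_sq (π * (L * r + I * a))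
  rw [h2] at h3
  simp at h3
  have h4 : Real.sinh (π * (L.re * r)) = 0 := by
    by_contra h; have := pow_pos (abs_pos.mpr h) 2; rw [sq_abs] at this
    nlinarith [sq_nonneg (Real.sin (π * (L.im * r + a)))]
  have h5 : Real.sin (π * (L.im * r + a)) = 0 := by
    rw [h4] at h3; simpa using h3.symm
  rw [Real.sinh_eq_zero] at h4
  have hr : r = 0 := by simpa [Real.pi_ne_zero, hL.ne'] using h4
  subst hr
  simp at h5 h1
  have ha' : 0 < a := lt_of_le_of_ne ha.1 (Ne.symm h1)
  have := Real.sin_pos_of_pos_of_lt_pi (x := π * a) (by positivity) (by nlinarith [Real.pi_pos, ha.2])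
  linarith

lemma norm_cos_le (u : ℂ) : ‖Complex.cos u‖ ≤ Real.exp |u.im| := by
  rw [Complex.cos, norm_div]
  have h1 : ‖Complex.exp (u * I)‖ ≤ Real.exp |u.im| := by
    rw [Complex.norm_exp]; apply Real.exp_le_exp.mpr; simp; exact neg_le_abs _
  have h2 : ‖Complex.exp (-u * I)‖ ≤ Real.exp |u.im| := by
    rw [Complex.norm_exp]; apply Real.exp_le_exp.mpr; simp; exact le_abs_self _
  have h3 := norm_add_le (Complex.exp (u * I)) (Complex.exp (-u * I))
  simp only [Complex.norm_ofNat]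
  linarith

lemma chi_side {M : ℝ} {t : ℂ} (ht : t ∈ cone M) (hX : 1 ≤ π * (Lam t).re) (Y : ℝ) {ε : ℝ}
    (hε : ε = 1 ∨ ε = -1) {a : ℝ} (ha : a ∈ Set.Icc (0 : ℝ) (1 / 2)) :
    ‖chi t Y (Lam t * (ε : ℂ) + I * a)‖ ≤ 8 * Real.exp (-(π ^ 2 / 4) * (t⁻¹).re + t.re * |Y|) := by
  have htn := cone_ne ht
  set v := Lam t * (ε : ℂ) + I * a with hv
  have hε2 : ε ^ 2 = 1 := by rcases hε with h | h <;> rw [h] <;> norm_num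
  have hε2' : (ε : ℂ) ^ 2 = 1 := by exact_mod_cast hε2
  have hεa : |ε| = 1 := by rcases hε with h | h <;> rw [h] <;> norm_num
  have hvre : |(π * v).re| = π * (Lam t).re := by
    have : (π * v).re = π * (Lam t).re * ε := by rw [hv]; simp; ring
    rw [this, abs_mul, hεa, mul_one, abs_of_pos (by linarith)]
  have hv0 : v ≠ 0 := by
    intro h; rw [h] at hvre; rw [mul_zero, Complex.zero_re, abs_zero] at hvre; linarith
  have hre : (t * v ^ 2).re ≤ π ^ 2 / 4 * (t⁻¹).re := by
    have : t * v ^ 2 = ((π ^ 2 / 4 : ℝ) : ℂ) * t⁻¹ + ((π * ε * a : ℝ) : ℂ) * I - ((a ^ 2 : ℝ) : ℂ) * t := by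
      rw [hv, Lam]; push_cast
      have : (π / (2 * t) * (ε : ℂ) + I * a) ^ 2 = π ^ 2 / (4 * t ^ 2) * (ε : ℂ) ^ 2 + π / t * ε * a * I + I ^ 2 * a ^ 2 := by
        field_simp; ring
      rw [this, hε2', Complex.I_sq]; field_simp; ring
    rw [this, Complex.sub_re, Complex.add_re, Complex.re_ofReal_mul, Complex.re_ofReal_mul, Complex.re_ofReal_mul]
    simp
    have := ht.1
    positivity
  have him : |(2 * t * Y * v).im| ≤ t.re * |Y| := by
    have : 2 * t * Y * v = ((π * Y * ε : ℝ) : ℂ) + ((2 * a * Y : ℝ) : ℂ) * (t * I) := by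
      rw [hv, Lam]; push_cast; field_simp
    rw [this, Complex.add_im, Complex.im_ofReal_mul, Complex.ofReal_im]
    simp
    rw [abs_of_pos ht.1, abs_of_nonneg ha.1]
    have h3 : 0 ≤ t.re * |Y| := mul_nonneg ht.1.le (abs_nonneg _)
    nlinarith [ha.2]
  have hm : ‖mfun t Y v‖ ≤ Real.exp (π ^ 2 / 4 * (t⁻¹).re + t.re * |Y|) := by
    rw [mfun, norm_mul, Real.exp_add]
    apply mul_le_mul
    · rw [Complex.norm_exp]; exact Real.exp_le_exp.mpr hre
    · exact (norm_cos_le _).trans (Real.exp_le_exp.mpr him)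
    · exact norm_nonneg _
    · positivity
  have hinv := (inv_cone ht).1
  have h1le : 1 ≤ Real.exp (π ^ 2 / 4 * (t⁻¹).re + t.re * |Y|) := by
    apply Real.one_le_exp
    have := ht.1
    positivity
  have hnum : ‖mfun t Y v - 1‖ ≤ 2 * Real.exp (π ^ 2 / 4 * (t⁻¹).re + t.re * |Y|) := by
    refine (norm_sub_le _ _).trans ?_
    rw [norm_one]; linarith
  have hden : 1 / 4 * Real.exp (π ^ 2 / 2 * (t⁻¹).re) ≤ ‖-I * Complex.sinh (π * v)‖ := by
    rw [norm_mul, norm_neg, Complex.norm_I, one_mul]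
    refine le_trans ?_ (abs_sinh_le_norm_sinh _)
    have h := sinh_lower (δ := 1) (a := (π * v).re) (by rw [hvre]; exact hX)
    refine le_trans ?_ h
    rw [hvre, Lam_re, show π * (π / 2 * (t⁻¹).re) = π ^ 2 / 2 * (t⁻¹).re by ring]
    refine mul_le_mul_of_nonneg_right ?_ (Real.exp_pos _).le
    have : Real.exp (-2 * 1) ≤ 1 / 2 := by
      have h4 := Real.add_one_le_exp (2 : ℝ)
      rw [show (-2 * 1 : ℝ) = -2 by norm_num, Real.exp_neg, inv_le_comm₀ (Real.exp_pos _) (by norm_num)]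
      linarith
    linarith
  rw [chi_of_ne _ _ hv0, norm_div]
  calc _ ≤ 2 * Real.exp (π ^ 2 / 4 * (t⁻¹).re + t.re * |Y|) / (1 / 4 * Real.exp (π ^ 2 / 2 * (t⁻¹).re)) := by
        apply div_le_div₀ (by positivity) hnum (by positivity) hden
    _ = 8 * (Real.exp (π ^ 2 / 4 * (t⁻¹).re + t.re * |Y|) / Real.exp (π ^ 2 / 2 * (t⁻¹).re)) := by
        field_simp; norm_num
    _ = _ := by rw [← Real.exp_sub]; congr 2; ring

lemma chi_int_bound {M : ℝ} {t : ℂ} (ht : t ∈ cone M) (hX : 1 ≤ π * (Lam t).re) (Y : ℝ) :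
    ‖∫ r in (-1 : ℝ)..1, Lam t * chi t Y (Lam t * r + I * ((1 / 2 : ℝ) : ℂ))‖ ≤
      8 * Real.exp (-(π ^ 2 / 4) * (t⁻¹).re + t.re * |Y|) := by
  have hL : 0 < (Lam t).re := (Lam_cone ht).1
  have key := contour_shift (Lam t) (chi t Y) (fun r _ a ha => chi_diff t Y (sinh_ne_strip hL r a ha))
  have h0 : ∫ r in (-1 : ℝ)..1, Lam t * chi t Y (Lam t * r + I * ((0 : ℝ) : ℂ)) = 0 := by
    have := intervalIntegral.integral_comp_neg (a := -1) (b := 1)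
      (fun r : ℝ => Lam t * chi t Y (Lam t * r + I * ((0 : ℝ) : ℂ)))
    rw [neg_neg] at this
    have h2 : ∫ r in (-1 : ℝ)..1, Lam t * chi t Y (Lam t * ((-r : ℝ) : ℂ) + I * ((0 : ℝ) : ℂ)) =
      - ∫ r in (-1 : ℝ)..1, Lam t * chi t Y (Lam t * r + I * ((0 : ℝ) : ℂ)) := by
      rw [← intervalIntegral.integral_neg]
      apply intervalIntegral.integral_congr
      intro r _
      simp only
      rw [show Lam t * ((-r : ℝ) : ℂ) + I * ((0 : ℝ) : ℂ) = -(Lam t * r + I * ((0 : ℝ) : ℂ)) by push_cast; ring, chi_odd]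
      ring
    rw [h2] at this
    exact self_eq_neg.mp this.symm
  rw [h0, sub_zero] at key
  rw [key]
  have side : ∀ ε : ℝ, (ε = 1 ∨ ε = -1) → ‖∫ a in (0 : ℝ)..(1 / 2), -I * chi t Y (Lam t * (ε : ℂ) + I * a)‖ ≤
      4 * Real.exp (-(π ^ 2 / 4) * (t⁻¹).re + t.re * |Y|) := by
    intro ε hε
    have := intervalIntegral.norm_integral_le_of_norm_le_const (a := 0) (b := 1 / 2)
      (f := fun a : ℝ => -I * chi t Y (Lam t * (ε : ℂ) + I * a))
      (C := 8 * Real.exp (-(π ^ 2 / 4) * (t⁻¹).re + t.re * |Y|)) (by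
        intro a ha
        rw [Set.uIoc_of_le (by norm_num)] at ha
        rw [norm_mul, norm_neg, Complex.norm_I, one_mul]
        exact chi_side ht hX Y hε ⟨ha.1.le, ha.2⟩)
    refine this.trans (le_of_eq ?_)
    rw [sub_zero, abs_of_pos (show (0:ℝ) < 1 / 2 by norm_num)]; ring
  refine (norm_sub_le _ _).trans ?_
  have h1 := side (-1) (Or.inr rfl)
  have h2 := side 1 (Or.inl rfl)
  linarith

lemma Et_cont {M : ℝ} (hM : 0 ≤ M) {t : ℂ} (ht : t ∈ cone M) (y : ℝ) :
    Continuous (fun r : ℝ => Complex.exp (t * (Lam t * r + I * y) ^ 2) / Complex.cosh (π * (Lam t * r))) := by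
  refine Continuous.div (by fun_prop) (by fun_prop) fun r => ?_
  exact cosh_ne_cone hM (cone_real (cone_abs (Lam_cone ht)) r)

lemma Et_pair {M : ℝ} (hM : 0 ≤ M) {t : ℂ} (ht : t ∈ cone M) (hX : 1 ≤ π * (Lam t).re) (Y : ℝ) :
    ‖Et t (Y - 1 / 2) + Et t (Y + 1 / 2) - Q0 t * Complex.exp (-t * (Y : ℂ) ^ 2)‖ ≤
      8 * Real.exp (-(π ^ 2 / 4) * (t⁻¹).re) * Real.exp (-t.re * (Y ^ 2 - |Y|)) := by
  have hL : 0 < (Lam t).re := (Lam_cone ht).1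
  have h1 : Et t (Y - 1 / 2) + Et t (Y + 1 / 2) - Q0 t * Complex.exp (-t * (Y : ℂ) ^ 2) =
      Complex.exp (-t * (Y : ℂ) ^ 2) * ∫ r in (-1 : ℝ)..1, Lam t * chi t Y (Lam t * r + I * ((1 / 2 : ℝ) : ℂ)) := by
    rw [← Et_even t (Y - 1 / 2), Et, Et, Q0, ← intervalIntegral.integral_const_mul,
      ← intervalIntegral.integral_const_mul, ← intervalIntegral.integral_const_mul,
      ← intervalIntegral.integral_const_mul, ← intervalIntegral.integral_mul_const,
      ← intervalIntegral.integral_add, ← intervalIntegral.integral_sub]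
    · apply intervalIntegral.integral_congr
      intro r _
      simp only
      have hc := cosh_ne_cone hM (cone_real (cone_abs (Lam_cone ht)) r)
      have hv0 : Lam t * r + I * ((1 / 2 : ℝ) : ℂ) ≠ 0 := by
        intro h
        have h2 := congrArg Complex.re h
        simp at h2
        rcases h2 with h2 | h2
        · exact hL.ne' h2
        · rw [h2] at h; simp at h
      have hcs : -I * Complex.sinh (π * (Lam t * r + I * ((1 / 2 : ℝ) : ℂ))) = Complex.cosh (π * (Lam t * r)) := by
        rw [show (π * (Lam t * r + I * ((1 / 2 : ℝ) : ℂ)) : ℂ) = π * (Lam t * r) + (π / 2) * I by push_cast; ring,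
          Complex.sinh_add, Complex.cosh_mul_I, Complex.sinh_mul_I, Complex.cos_pi_div_two, Complex.sin_pi_div_two]
        linear_combination (-Complex.cosh (π * (Lam t * r))) * Complex.I_sq
      rw [chi_of_ne _ _ hv0, hcs, mfun, f0, Complex.cos]
      have e1 : Complex.exp (t * (Lam t * r + I * ((-(Y - 1 / 2) : ℝ) : ℂ)) ^ 2) =
          Complex.exp (-t * (Y : ℂ) ^ 2) * (Complex.exp (t * (Lam t * r + I * ((1 / 2 : ℝ) : ℂ)) ^ 2) *
            Complex.exp (-(2 * t * Y * (Lam t * r + I * ((1 / 2 : ℝ) : ℂ))) * I)) := by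
        rw [← Complex.exp_add, ← Complex.exp_add]; congr 1; push_cast
        linear_combination (t * Y ^ 2) * Complex.I_sq
      have e2 : Complex.exp (t * (Lam t * r + I * ((Y + 1 / 2 : ℝ) : ℂ)) ^ 2) =
          Complex.exp (-t * (Y : ℂ) ^ 2) * (Complex.exp (t * (Lam t * r + I * ((1 / 2 : ℝ) : ℂ)) ^ 2) *
            Complex.exp ((2 * t * Y * (Lam t * r + I * ((1 / 2 : ℝ) : ℂ))) * I)) := by
        rw [← Complex.exp_add, ← Complex.exp_add]; congr 1; push_cast
        linear_combination (t * Y ^ 2) * Complex.I_sq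
      rw [e1, e2]
      simp only [Complex.ofReal_zero, mul_zero, neg_zero, zero_mul, Complex.exp_zero]
      field_simp
      ring
    · exact (((continuous_const.mul (Et_cont hM ht _)).add (continuous_const.mul (Et_cont hM ht _))).intervalIntegrable _ _)
    · exact ((continuous_const.mul (f0_cont hM 0 (cone_abs (Lam_cone ht)))).mul continuous_const).intervalIntegrable _ _
    · exact (continuous_const.mul (Et_cont hM ht _)).intervalIntegrable _ _
    · exact (continuous_const.mul (Et_cont hM ht _)).intervalIntegrable _ _
  rw [h1, norm_mul]
  refine (mul_le_mul_of_nonneg_left (chi_int_bound ht hX Y) (norm_nonneg _)).trans (le_of_eq ?_)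
  have e3 : ‖Complex.exp (-t * (Y : ℂ) ^ 2)‖ = Real.exp (-t.re * Y ^ 2) := by
    rw [Complex.norm_exp, show -t * (Y : ℂ) ^ 2 = ((Y ^ 2 : ℝ) : ℂ) * (-t) by push_cast; ring, Complex.re_ofReal_mul]
    congr 1; simp; ring
  rw [e3, mul_left_comm, ← Real.exp_add, mul_assoc, ← Real.exp_add]
  congr 2; ring

lemma Et_decay {M : ℝ} (hM : 0 ≤ M) {t : ℂ} (ht : t ∈ cone M) : ∃ K : ℝ, ∀ y : ℝ,
    ‖Et t y‖ ≤ K * Real.exp (-t.re * y ^ 2) := by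
  have htn := cone_ne ht
  have hc : Continuous (fun r : ℝ => ‖Complex.exp (t * (Lam t * r + I * ((0 : ℝ) : ℂ)) ^ 2) / Complex.cosh (π * (Lam t * r))‖) :=
    (Et_cont hM ht 0).norm
  refine ⟨‖1 / 2 * Lam t‖ * ∫ r in (-1 : ℝ)..1,
    ‖Complex.exp (t * (Lam t * r + I * ((0 : ℝ) : ℂ)) ^ 2) / Complex.cosh (π * (Lam t * r))‖, fun y => ?_⟩
  rw [Et, norm_mul, mul_assoc]
  refine mul_le_mul_of_nonneg_left ?_ (norm_nonneg _)
  refine (intervalIntegral.norm_integral_le_integral_norm (by norm_num)).trans (le_of_eq ?_)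
  rw [← intervalIntegral.integral_mul_const]
  apply intervalIntegral.integral_congr
  intro r _
  simp only
  have : t * (Lam t * r + I * (y : ℂ)) ^ 2 = t * (Lam t * r + I * ((0 : ℝ) : ℂ)) ^ 2 +
      (((π * r * y : ℝ) : ℂ) * I + ((-y ^ 2 : ℝ) : ℂ) * t) := by
    rw [Lam]; push_cast; field_simp
    linear_combination (4 * t ^ 2 * y ^ 2) * Complex.I_sq
  rw [this, Complex.exp_add, norm_div, norm_mul, norm_div, Complex.norm_exp (_ + _), Complex.add_re,
    Complex.re_ofReal_mul, Complex.re_ofReal_mul]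
  simp
  ring_nf

lemma rec_bound {d : ℕ → ℂ} (hd : Tendsto d atTop (𝓝 0)) {A r : ℝ} (hA : 0 ≤ A) (hr : 0 ≤ r) (hr1 : r < 1)
    (h : ∀ k, ‖d k + d (k + 1)‖ ≤ A * r ^ (k ^ 2 + k)) (k : ℕ) : ‖d k‖ ≤ A * r ^ (k ^ 2 + k) / (1 - r) := by
  have h1r : 0 < 1 - r := by linarith
  set b : ℕ → ℝ := fun k => A * r ^ (k ^ 2 + k) / (1 - r) with hb
  have hmono : Monotone (fun k => ‖d k‖ - b k) := by
    apply monotone_nat_of_le_succ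
    intro k
    have e1 : ‖d k‖ ≤ A * r ^ (k ^ 2 + k) + ‖d (k + 1)‖ := by
      have : d k = (d k + d (k + 1)) - d (k + 1) := by ring
      calc ‖d k‖ = ‖(d k + d (k + 1)) - d (k + 1)‖ := by rw [← this]
        _ ≤ _ := (norm_sub_le _ _).trans (add_le_add_left (h k) _)
    have e2 : b (k + 1) ≤ r * b k := by
      simp only [hb]
      have : r ^ ((k + 1) ^ 2 + (k + 1)) ≤ r * r ^ (k ^ 2 + k) := by
        rw [← pow_succ']
        apply pow_le_pow_of_le_one hr hr1.le
        nlinarith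
      rw [← mul_div_assoc]
      apply div_le_div_of_nonneg_right _ h1r.le
      calc _ ≤ A * (r * r ^ (k ^ 2 + k)) := mul_le_mul_of_nonneg_left this hA
        _ = _ := by ring
    have e3 : A * r ^ (k ^ 2 + k) = (1 - r) * b k := by simp only [hb]; field_simp
    show ‖d k‖ - b k ≤ ‖d (k + 1)‖ - b (k + 1)
    nlinarith
  have hb0 : Tendsto b atTop (𝓝 0) := by
    have h1 : Tendsto (fun k : ℕ => r ^ (k ^ 2 + k)) atTop (𝓝 0) :=
      (tendsto_pow_atTop_nhds_zero_of_lt_one hr hr1).comp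
        (tendsto_atTop_mono (fun k => by nlinarith : ∀ k : ℕ, k ≤ k ^ 2 + k) tendsto_id)
    have := (h1.const_mul A).div_const (1 - r)
    simpa using this
  have hlim : Tendsto (fun k => ‖d k‖ - b k) atTop (𝓝 0) := by simpa using hd.norm.sub hb0
  have := hmono.ge_of_tendsto hlim k
  have h9 : ‖d k‖ - b k ≤ 0 := this
  linarith

def Gt (w t : ℂ) : ℂ := ∑' k : ℤ, w ^ k * gq t k * Complex.exp (t * ((k : ℂ) ^ 2 + k + 1)) * Et t (k + 1 / 2)

lemma int_cases (k : ℤ) : (∃ j : ℕ, k = j) ∨ ∃ j : ℕ, k = -1 - (j : ℤ) := by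
  rcases le_or_gt 0 k with h | h
  · left; exact ⟨k.toNat, by omega⟩
  · right; exact ⟨(-1 - k).toNat, by omega⟩

lemma F_bound {M : ℝ} (hM : 0 ≤ M) {t w : ℂ} (ht : t ∈ cone M) (hX : 1 ≤ π * (Lam t).re) (hw : ‖w‖ = 1)
    (hQ : Q0 t ≠ 0) {p : ℤ → ℂ} (hp1 : ∀ k, p (-1 - k) = p k)
    (hp2 : ∀ k : ℕ, p k + p (k + 1) = Complex.exp (-t * ((k : ℂ) + 1) ^ 2))
    (hp3 : Tendsto (fun k : ℕ => p k) atTop (𝓝 0))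
    (hp4 : Summable (fun k : ℤ => w ^ k * gq t k * Complex.exp (t * ((k : ℂ) ^ 2 + k + 1)) * p k)) :
    ‖(∑' k : ℤ, w ^ k * gq t k * Complex.exp (t * ((k : ℂ) ^ 2 + k + 1)) * p k) - (Q0 t)⁻¹ * Gt w t‖ ≤
      16 * Real.exp t.re * Real.exp (-(π ^ 2 / 4) * (t⁻¹).re) / (‖Q0 t‖ * (1 - Real.exp (-t.re)) ^ 2) := by
  set r := Real.exp (-t.re) with hr
  have hr0 : 0 < r := Real.exp_pos _
  have hr1 : r < 1 := by rw [hr, Real.exp_lt_one_iff]; linarith [ht.1]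
  have h1r : 0 < 1 - r := by linarith
  set ρ := Real.exp (-(π ^ 2 / 4) * (t⁻¹).re) with hρ
  set A := 8 * ρ / ‖Q0 t‖ with hA
  have hQn : 0 < ‖Q0 t‖ := norm_pos_iff.mpr hQ
  have hA0 : 0 ≤ A := by positivity
  set d : ℤ → ℂ := fun k => p k - Et t (k + 1 / 2) / Q0 t with hd
  have hdsym : ∀ k, d (-1 - k) = d k := by
    intro k
    simp only [hd, hp1]
    congr 2
    rw [← Et_even]; congr 1; push_cast; ring
  have hdlim : Tendsto (fun k : ℕ => d k) atTop (𝓝 0) := by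
    obtain ⟨K, hK⟩ := Et_decay hM ht
    have h1 : Tendsto (fun k : ℕ => Et t (k + 1 / 2)) atTop (𝓝 0) := by
      have h2 : Tendsto (fun k : ℕ => |K| * r ^ k) atTop (𝓝 0) := by
        simpa using (tendsto_pow_atTop_nhds_zero_of_lt_one hr0.le hr1).const_mul |K|
      refine squeeze_zero_norm (fun k => (hK _).trans ?_) h2
      refine (mul_le_mul_of_nonneg_right (le_abs_self K) (Real.exp_pos _).le).trans ?_
      refine mul_le_mul_of_nonneg_left ?_ (abs_nonneg _)
      rw [hr, ← Real.exp_nat_mul]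
      apply Real.exp_le_exp.mpr
      have := mul_nonneg ht.1.le (sq_nonneg (k : ℝ))
      nlinarith [ht.1]
    have := hp3.sub (h1.div_const (Q0 t))
    simpa [hd] using this
  have hrec : ∀ k : ℕ, ‖d k + d ((k + 1 : ℕ) : ℤ)‖ ≤ A * r ^ (k ^ 2 + k) := by
    intro k
    have h := Et_pair hM ht hX ((k : ℝ) + 1)
    have e : d k + d ((k + 1 : ℕ) : ℤ) = -(Et t ((k : ℝ) + 1 - 1 / 2) + Et t ((k : ℝ) + 1 + 1 / 2) -
        Q0 t * Complex.exp (-t * (((k : ℝ) + 1 : ℝ) : ℂ) ^ 2)) / Q0 t := by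
      simp only [hd]
      have e1 : Et t (((k : ℤ) : ℝ) + 1 / 2) = Et t ((k : ℝ) + 1 - 1 / 2) := by congr 1; push_cast; ring
      have e2 : Et t ((((k + 1 : ℕ) : ℤ) : ℝ) + 1 / 2) = Et t ((k : ℝ) + 1 + 1 / 2) := by congr 1; push_cast; ring
      have e3 := hp2 k
      have e4 : p ((k + 1 : ℕ) : ℤ) = p (k + 1) := by push_cast; rfl
      rw [e1, e2, e4]
      have e5 : Complex.exp (-t * (((k : ℝ) + 1 : ℝ) : ℂ) ^ 2) = Complex.exp (-t * ((k : ℂ) + 1) ^ 2) := by push_cast; rfl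
      rw [e5, ← e3]
      field_simp
      ring
    rw [e, norm_div, norm_neg]
    have e6 : Real.exp (-t.re * (((k : ℝ) + 1) ^ 2 - |(k : ℝ) + 1|)) = r ^ (k ^ 2 + k) := by
      rw [hr, ← Real.exp_nat_mul, abs_of_pos (by positivity)]; congr 1; push_cast; ring
    rw [e6] at h
    calc _ ≤ 8 * ρ * r ^ (k ^ 2 + k) / ‖Q0 t‖ := div_le_div_of_nonneg_right h hQn.le
      _ = _ := by rw [hA]; ring
  have hdn := rec_bound hdlim hA0 hr0.le hr1 hrec
  have hdz : ∀ k : ℤ, ‖d k‖ ≤ A * Real.exp (-t.re * ((k : ℝ) ^ 2 + k)) / (1 - r) := by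
    intro k
    rcases int_cases k with ⟨j, rfl⟩ | ⟨j, rfl⟩
    · refine (hdn j).trans (le_of_eq ?_)
      rw [hr, ← Real.exp_nat_mul]; congr 3; push_cast; ring
    · rw [hdsym]
      refine (hdn j).trans (le_of_eq ?_)
      rw [hr, ← Real.exp_nat_mul]; congr 3; push_cast; ring
  obtain ⟨hs, hsl⟩ := gsum_le ht.1
  set c : ℤ → ℂ := fun k => w ^ k * gq t k * Complex.exp (t * ((k : ℂ) ^ 2 + k + 1)) with hc
  have hterm : ∀ k : ℤ, ‖c k * d k‖ ≤ Real.exp t.re * A / (1 - r) * Real.exp (-t.re * ((k : ℝ) * (k + 1) / 2)) := by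
    intro k
    have e1 : ‖Complex.exp (t * ((k : ℂ) ^ 2 + k + 1))‖ = Real.exp t.re * Real.exp (t.re * ((k : ℝ) ^ 2 + k)) := by
      rw [Complex.norm_exp, ← Real.exp_add,
        show ((k : ℂ) ^ 2 + k + 1) = (((k : ℝ) ^ 2 + k + 1 : ℝ) : ℂ) by push_cast; ring, Complex.re_mul_ofReal]
      congr 1; ring
    rw [norm_mul, hc]
    simp only
    rw [norm_mul, norm_mul, norm_zpow, hw, one_zpow, one_mul, norm_gq, e1]
    refine (mul_le_mul_of_nonneg_left (hdz k) (by positivity)).trans (le_of_eq ?_)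
    rw [show -t.re * ((k : ℝ) ^ 2 + k) = -(t.re * ((k : ℝ) ^ 2 + k)) by ring, Real.exp_neg]
    have := (Real.exp_pos (t.re * ((k : ℝ) ^ 2 + k))).ne'
    field_simp
  have hsd : Summable (fun k => c k * d k) := Summable.of_norm_bounded (hs.mul_left _) hterm
  have hG : Summable (fun k : ℤ => c k * Et t (k + 1 / 2)) := by
    refine ((hp4.sub hsd).mul_left (Q0 t)).congr fun k => ?_
    simp only [hc, hd]; field_simp; ring
  have heq : (∑' k : ℤ, c k * p k) - (Q0 t)⁻¹ * Gt w t = ∑' k, c k * d k := by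
    rw [Gt, ← tsum_mul_left, ← Summable.tsum_sub hp4 (hG.mul_left _)]
    apply tsum_congr
    intro k
    simp only [hc, hd]; field_simp
  rw [heq]
  refine (tsum_of_norm_bounded (hs.mul_left _).hasSum hterm).trans ?_
  rw [tsum_mul_left]
  rw [← hr] at hsl
  refine (mul_le_mul_of_nonneg_left hsl (by positivity)).trans (le_of_eq ?_)
  rw [hA]; field_simp; ring

lemma Gt_eq1 {M : ℝ} (hM : 0 ≤ M) {t w : ℂ} (ht : t ∈ cone M) {z : ℝ} (hw : w = Complex.exp (2 * π * I * z)) :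
    Gt w t = Complex.exp (7 * t / 8) * (1 / 2 * Lam t) * ∫ r in (-1 : ℝ)..1,
      (Complex.exp (t * (Lam t * r) ^ 2) / Complex.cosh (π * (Lam t * r))) *
      ∑' k : ℤ, Complex.exp (2 * π * I * z * k + π * I * r * (k + 1 / 2) - t * ((k : ℂ) + 1 / 2) ^ 2 / 2) := by
  have htn := cone_ne ht
  set D : ℝ → ℂ := fun r => Complex.exp (t * (Lam t * r) ^ 2) / Complex.cosh (π * (Lam t * r)) with hD
  have hDc : Continuous D := by
    have := Et_cont hM ht 0
    simpa [hD] using this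
  set e : ℤ → ℝ → ℂ := fun k r =>
    Complex.exp (2 * π * I * z * k + π * I * r * (k + 1 / 2) - t * ((k : ℂ) + 1 / 2) ^ 2 / 2) with he
  have hen : ∀ k r, ‖e k r‖ ≤ Real.exp (-t.re * ((k : ℝ) * (k + 1) / 2)) := by
    intro k r
    simp only [he]
    rw [Complex.norm_exp]
    apply Real.exp_le_exp.mpr
    have : (2 * π * I * z * k + π * I * r * (k + 1 / 2) - t * ((k : ℂ) + 1 / 2) ^ 2 / 2 : ℂ) =
      ((2 * π * z * k + π * r * (k + 1 / 2) : ℝ) : ℂ) * I + ((-((k : ℝ) + 1 / 2) ^ 2 / 2 : ℝ) : ℂ) * t := by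
      push_cast; ring
    rw [this, Complex.add_re, Complex.re_ofReal_mul, Complex.re_ofReal_mul, Complex.I_re]
    nlinarith [ht.1]
  obtain ⟨hs, -⟩ := gsum_le ht.1
  have key : HasSum (fun k : ℤ => ∫ r in (-1 : ℝ)..1, D r * e k r) (∫ r in (-1 : ℝ)..1, D r * ∑' k : ℤ, e k r) := by
    refine intervalIntegral.hasSum_integral_of_dominated_convergence (ι := ℤ) (F := fun k r => D r * e k r)
      (fun k r => ‖D r‖ * Real.exp (-t.re * ((k : ℝ) * (k + 1) / 2))) ?_ ?_ ?_ ?_ ?_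
    · intro k
      refine Continuous.aestronglyMeasurable (hDc.mul ?_)
      simp only [he]; fun_prop
    · intro k
      refine .of_forall fun r _ => ?_
      rw [norm_mul]
      exact mul_le_mul_of_nonneg_left (hen k r) (norm_nonneg _)
    · exact .of_forall fun r _ => hs.mul_left _
    · simp only [tsum_mul_left]
      exact (hDc.norm.mul continuous_const).intervalIntegrable _ _
    · refine .of_forall fun r _ => ?_
      exact (Summable.of_norm_bounded hs (fun k => hen k r)).hasSum.mul_left _
  rw [← key.tsum_eq, ← tsum_mul_left, Gt]
  apply tsum_congr
  intro k
  rw [Et, hw, gq, ← Complex.exp_int_mul]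
  rw [mul_left_comm, mul_assoc (Complex.exp (7 * t / 8)), mul_left_comm (Complex.exp (7 * t / 8))]
  congr 1
  rw [← intervalIntegral.integral_const_mul, ← intervalIntegral.integral_const_mul]
  apply intervalIntegral.integral_congr
  intro r _
  simp only [hD, he]
  have hc := cosh_ne_cone hM (cone_real (cone_abs (Lam_cone ht)) r)
  have gen : ∀ a b c x y u v d : ℂ, a * b * c * x = y * (u * v) → a * b * c * (x / d) = y * (u / d * v) := by
    intro a b c x y u v d h
    linear_combination d⁻¹ * h
  apply gen
  simp only [← Complex.exp_add]
  congr 1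
  rw [Lam]; push_cast; field_simp
  linear_combination (16 * t ^ 2 * (k * 2 + 1) ^ 2 ) * Complex.I_sq

lemma theta_poisson {t : ℂ} (ht : 0 < t.re) (z r : ℝ) :
    ∑' k : ℤ, Complex.exp (2 * π * I * z * k + π * I * r * (k + 1 / 2) - t * ((k : ℂ) + 1 / 2) ^ 2 / 2) =
    Complex.exp (-(π * I * z)) * (1 / (t / (2 * π)) ^ (1 / 2 : ℂ)) *
      ∑' n : ℤ, Complex.exp (π * I * n - 2 * π ^ 2 / t * ((n : ℂ) - (z + r / 2)) ^ 2) := by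
  have htn : t ≠ 0 := by rintro rfl; simp at ht
  have hpi : (π : ℂ) ≠ 0 := by exact_mod_cast Real.pi_ne_zero
  have ha : 0 < (t / (2 * π)).re := by
    rw [show (t / (2 * π) : ℂ) = ((1 / (2 * π) : ℝ) : ℂ) * t by push_cast; field_simp, Complex.re_ofReal_mul]
    positivity
  have := Complex.tsum_exp_neg_quadratic ha (I * (z + r / 2) - t / (4 * π))
  have h1 : ∀ k : ℤ, Complex.exp (2 * π * I * z * k + π * I * r * (k + 1 / 2) - t * ((k : ℂ) + 1 / 2) ^ 2 / 2) =
      Complex.exp (π * I * r / 2 - t / 8) *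
        Complex.exp (-π * (t / (2 * π)) * (k : ℂ) ^ 2 + 2 * π * (I * (z + r / 2) - t / (4 * π)) * k) := by
    intro k
    rw [← Complex.exp_add]; congr 1; field_simp; ring
  have h2 : ∀ n : ℤ, Complex.exp (-π / (t / (2 * π)) * ((n : ℂ) + I * (I * (z + r / 2) - t / (4 * π))) ^ 2) =
      Complex.exp (-(π * I * r / 2) - π * I * z + t / 8) *
      Complex.exp (π * I * n - 2 * π ^ 2 / t * ((n : ℂ) - (z + r / 2)) ^ 2) := by
    intro n
    rw [← Complex.exp_add]; congr 1
    have : (n : ℂ) + I * (I * (z + r / 2) - t / (4 * π)) = (n - (z + r / 2)) - I * t / (4 * π) := by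
      linear_combination ((z : ℂ) + r / 2) * Complex.I_sq
    rw [this]
    set u := (n : ℂ) - (z + r / 2) with hu
    have hn : (n : ℂ) = u + (z + r / 2) := by rw [hu]; ring
    rw [hn]
    field_simp
    linear_combination (-32 * t ^ 2) * Complex.I_sq
  simp only [h1, tsum_mul_left, this, h2]
  rw [show ∀ a b c d : ℂ, a * (b * (c * d)) = (a * c) * b * d by intros; ring, ← Complex.exp_add]
  congr 3
  ring

lemma bracket {z r : ℝ} (hz : 0 < z) (hz' : z < 1 / 4) (hr : |r| ≤ 1) (n : ℤ) :
    r ^ 2 / 4 - |r| / 2 - 2 * ((n : ℝ) - (z + r / 2)) ^ 2 + 2 * z ^ 2 ≤ -(n : ℝ) ^ 2 / 4 := by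
  have h1 := le_abs_self r
  have h2 := neg_abs_le r
  have h3 := abs_le.mp hr
  rcases lt_trichotomy n 0 with h | h | h
  · have hn : (n : ℝ) ≤ -1 := by exact_mod_cast (show n ≤ -1 by omega)
    obtain ⟨m, hm⟩ : ∃ m : ℝ, (n : ℝ) = -m := ⟨-n, by ring⟩
    rw [hm] at hn ⊢
    have hm1 : 1 ≤ m := by linarith
    have e1 : 0 ≤ (1 + r) * (2 * m + 2 * z - 1) := mul_nonneg (by linarith) (by linarith)
    nlinarith [mul_nonneg hz.le (sub_nonneg.mpr hm1), sq_nonneg (m - 1), sq_nonneg (1 + r)]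
  · subst h; push_cast
    nlinarith [mul_nonneg (show 0 ≤ 1 / 4 - z by linarith) (abs_nonneg r), mul_nonneg hz.le (show 0 ≤ |r| + r by linarith), sq_nonneg r]
  · have hn : (1 : ℝ) ≤ n := by exact_mod_cast h
    set m := (n : ℝ)
    have e1 : 0 ≤ (1 - r) * (2 * m - 2 * z - 1) := mul_nonneg (by linarith) (by linarith)
    nlinarith [mul_nonneg (show 0 ≤ 1 / 4 - z by linarith) (sub_nonneg.mpr hn), sq_nonneg (m - 1), sq_nonneg (1 - r)]

lemma tendsto_X {M : ℝ} (hM : 0 ≤ M) : Tendsto (fun t : ℂ => (t⁻¹).re) (𝓝[cone M] 0) atTop := by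
  have h := (tendsto_lamR M).const_mul_atTop (show 0 < 2 / (π * (1 + M)) by positivity)
  refine tendsto_atTop_mono' _ ?_ h
  filter_upwards [self_mem_nhdsWithin] with t ht
  have h1 := cone_norm_le (inv_cone ht)
  rw [norm_inv] at h1
  have hn := norm_pos_iff.mpr (cone_ne ht)
  have : 2 / (π * (1 + M)) * (π / (2 * ‖t‖)) = ‖t‖⁻¹ / (1 + M) := by field_simp
  rw [this, div_le_iff₀ (by linarith)]; linarith

def Hn (z : ℝ) (t : ℂ) (n : ℤ) (r : ℝ) : ℂ :=
  Complex.exp (t * (Lam t * r) ^ 2) / Complex.cosh (π * (Lam t * r)) *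
    (Complex.exp (π * I * n - 2 * π ^ 2 / t * ((n : ℂ) - (z + r / 2)) ^ 2) * Complex.exp (2 * π ^ 2 * z ^ 2 / t))

lemma Hn_cont {M : ℝ} (hM : 0 ≤ M) {t : ℂ} (ht : t ∈ cone M) (z : ℝ) (n : ℤ) : Continuous (Hn z t n) := by
  have := Et_cont hM ht 0
  simp only [Complex.ofReal_zero, mul_zero, add_zero] at this
  unfold Hn
  exact this.mul (by fun_prop)

lemma Hn_bound {M : ℝ} (hM : 0 ≤ M) : ∃ C : ℝ, 0 < C ∧ ∀ z : ℝ, 0 < z → z < 1 / 4 → ∀ t ∈ cone M, ∀ n : ℤ, ∀ r : ℝ,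
    |r| ≤ 1 → ‖Hn z t n r‖ ≤ C * Real.exp (-2 * (t⁻¹).re * (n : ℝ) ^ 2) := by
  obtain ⟨c, hc, H⟩ := cosh_lower hM
  refine ⟨1 / c, by positivity, fun z hz hz' t ht n r hr => ?_⟩
  have htn := cone_ne ht
  have hX := (inv_cone ht).1
  set X := (t⁻¹).re with hXd
  have hcosh : c * Real.exp (π ^ 2 / 2 * X * |r|) ≤ ‖Complex.cosh (π * (Lam t * r))‖ := by
    refine le_trans (le_of_eq ?_) (H _ (cone_pi (cone_real (cone_abs (Lam_cone ht)) r)))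
    congr 2
    rw [Complex.re_ofReal_mul, Complex.re_mul_ofReal, Lam_re, abs_mul, abs_mul, abs_mul,
      abs_of_pos Real.pi_pos, abs_of_pos hX, abs_of_pos (by positivity : 0 < π / 2)]
    ring
  have hnum : ‖Complex.exp (t * (Lam t * r) ^ 2) *
      (Complex.exp (π * I * n - 2 * π ^ 2 / t * ((n : ℂ) - (z + r / 2)) ^ 2) * Complex.exp (2 * π ^ 2 * z ^ 2 / t))‖ =
      Real.exp (π ^ 2 * X * (r ^ 2 / 4 - 2 * ((n : ℝ) - (z + r / 2)) ^ 2 + 2 * z ^ 2)) := by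
    rw [← Complex.exp_add, ← Complex.exp_add, Complex.norm_exp]
    congr 1
    have : t * (Lam t * r) ^ 2 + (π * I * n - 2 * π ^ 2 / t * ((n : ℂ) - (z + r / 2)) ^ 2 + 2 * π ^ 2 * z ^ 2 / t) =
      ((π * n : ℝ) : ℂ) * I + ((π ^ 2 * (r ^ 2 / 4 - 2 * ((n : ℝ) - (z + r / 2)) ^ 2 + 2 * z ^ 2) : ℝ) : ℂ) * t⁻¹ := by
      rw [Lam]; push_cast; field_simp; ring
    rw [this, Complex.add_re, Complex.re_ofReal_mul, Complex.re_ofReal_mul, Complex.I_re]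
    ring
  rw [Hn, div_mul_eq_mul_div, norm_div, hnum]
  have hpi : 8 ≤ π ^ 2 := by nlinarith [Real.pi_gt_three]
  calc _ ≤ Real.exp (π ^ 2 * X * (r ^ 2 / 4 - 2 * ((n : ℝ) - (z + r / 2)) ^ 2 + 2 * z ^ 2)) /
        (c * Real.exp (π ^ 2 / 2 * X * |r|)) := by
        apply div_le_div_of_nonneg_left (Real.exp_pos _).le (by positivity) hcosh
    _ = 1 / c * Real.exp (π ^ 2 * X * (r ^ 2 / 4 - 2 * ((n : ℝ) - (z + r / 2)) ^ 2 + 2 * z ^ 2) - π ^ 2 / 2 * X * |r|) := by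
        rw [Real.exp_sub]; field_simp
    _ ≤ _ := by
        refine mul_le_mul_of_nonneg_left (Real.exp_le_exp.mpr ?_) (by positivity)
        have hb := mul_le_mul_of_nonneg_left (bracket hz hz' hr n) (show 0 ≤ π ^ 2 * X by positivity)
        have h2 := mul_le_mul_of_nonneg_right hpi (show 0 ≤ X * (n : ℝ) ^ 2 by positivity)
        nlinarith

lemma summable_exp_abs : Summable (fun n : ℤ => Real.exp (-|(n : ℝ)|)) := by
  have h : Summable (fun n : ℕ => Real.exp (-(n : ℝ))) := by
    have := Real.summable_exp_neg_nat
    simpa using this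
  refine Summable.of_nat_of_neg ?_ ?_ <;> simpa using h

lemma Hn_sum {M : ℝ} (hM : 0 ≤ M) {z : ℝ} (hz : 0 < z) (hz' : z < 1 / 4) : ∃ C : ℝ, 0 < C ∧ ∀ t ∈ cone M,
    1 ≤ (t⁻¹).re → ‖(∫ r in (-1 : ℝ)..1, ∑' n : ℤ, Hn z t n r) - ∫ r in (-1 : ℝ)..1, Hn z t 0 r‖ ≤
      C * Real.exp (-(t⁻¹).re) := by
  obtain ⟨C, hC, H⟩ := Hn_bound hM
  refine ⟨2 * C * (∑' n : ℤ, Real.exp (-|(n : ℝ)|)), ?_, fun t ht hX => ?_⟩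
  · have := summable_exp_abs.tsum_pos (fun n => (Real.exp_pos _).le) 0 (Real.exp_pos _)
    positivity
  set X := (t⁻¹).re with hXd
  have hbd : ∀ n : ℤ, ∀ r : ℝ, |r| ≤ 1 → ‖Hn z t n r‖ ≤ C * Real.exp (-|(n : ℝ)|) := by
    intro n r hr
    refine (H z hz hz' t ht n r hr).trans (mul_le_mul_of_nonneg_left (Real.exp_le_exp.mpr ?_) hC.le)
    rcases eq_or_ne n 0 with rfl | hn
    · simp
    · have h1 : (1 : ℝ) ≤ |(n : ℝ)| := by exact_mod_cast Int.one_le_abs hn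
      rw [← sq_abs (n : ℝ)]
      have : |(n : ℝ)| ≤ |(n : ℝ)| ^ 2 := by nlinarith
      nlinarith
  have hbd2 : ∀ n : ℤ, n ≠ 0 → ∀ r : ℝ, |r| ≤ 1 → ‖Hn z t n r‖ ≤ C * Real.exp (-X) * Real.exp (-|(n : ℝ)|) := by
    intro n hn r hr
    refine (H z hz hz' t ht n r hr).trans ?_
    rw [mul_assoc C, ← Real.exp_add]
    refine mul_le_mul_of_nonneg_left (Real.exp_le_exp.mpr ?_) hC.le
    have h1 : (1 : ℝ) ≤ |(n : ℝ)| := by exact_mod_cast Int.one_le_abs hn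
    rw [← sq_abs (n : ℝ)]
    have : |(n : ℝ)| ≤ |(n : ℝ)| ^ 2 := by nlinarith
    nlinarith
  have habs : ∀ r ∈ Set.uIoc (-1 : ℝ) 1, |r| ≤ 1 := by
    intro r hr
    rw [Set.uIoc_of_le (by norm_num)] at hr
    exact abs_le.mpr ⟨hr.1.le, hr.2⟩
  have key : HasSum (fun n : ℤ => ∫ r in (-1 : ℝ)..1, Hn z t n r) (∫ r in (-1 : ℝ)..1, ∑' n : ℤ, Hn z t n r) := by
    refine intervalIntegral.hasSum_integral_of_dominated_convergence (ι := ℤ) (F := fun n r => Hn z t n r)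
      (fun n _ => C * Real.exp (-|(n : ℝ)|)) ?_ ?_ ?_ ?_ ?_
    · exact fun n => (Hn_cont hM ht z n).aestronglyMeasurable
    · exact fun n => .of_forall fun r hr => hbd n r (habs r hr)
    · exact .of_forall fun r _ => summable_exp_abs.mul_left C
    · exact continuous_const.intervalIntegrable _ _
    · exact .of_forall fun r hr => (Summable.of_norm_bounded (summable_exp_abs.mul_left C) (fun n => hbd n r (habs r hr))).hasSum
  rw [← key.tsum_eq, key.summable.tsum_eq_add_tsum_ite 0, add_sub_cancel_left]
  have hn : ∀ n : ℤ, ‖(if n = 0 then 0 else ∫ r in (-1 : ℝ)..1, Hn z t n r)‖ ≤ 2 * C * Real.exp (-X) * Real.exp (-|(n : ℝ)|) := by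
    intro n
    split_ifs with h
    · rw [norm_zero]; positivity
    · refine (intervalIntegral.norm_integral_le_of_norm_le_const (fun r hr => hbd2 n h r (habs r hr))).trans (le_of_eq ?_)
      norm_num; ring
  refine (tsum_of_norm_bounded (summable_exp_abs.mul_left _).hasSum hn).trans (le_of_eq ?_)
  rw [tsum_mul_left]; ring

lemma Gt_eq2 {M : ℝ} (hM : 0 ≤ M) {t w : ℂ} (ht : t ∈ cone M) {z : ℝ} (hw : w = Complex.exp (2 * π * I * z)) :
    Gt w t * Complex.exp (2 * π ^ 2 * z ^ 2 / t) * (t / (2 * π)) ^ (1 / 2 : ℂ) =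
      Complex.exp (7 * t / 8) * Complex.exp (-(π * I * z)) * (1 / 2) *
        (Lam t * ∫ r in (-1 : ℝ)..1, ∑' n : ℤ, Hn z t n r) := by
  have htn := cone_ne ht
  have hpi : (π : ℂ) ≠ 0 := by exact_mod_cast Real.pi_ne_zero
  have ha : (t / (2 * π)) ^ (1 / 2 : ℂ) ≠ 0 := by
    rw [Complex.cpow_def_of_ne_zero (div_ne_zero htn (by simp [hpi]))]; exact Complex.exp_ne_zero _
  rw [Gt_eq1 hM ht hw]
  simp only [theta_poisson ht.1]
  have : ∀ r : ℝ, Complex.exp (t * (Lam t * r) ^ 2) / Complex.cosh (π * (Lam t * r)) *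
      (Complex.exp (-(π * I * z)) * (1 / (t / (2 * π)) ^ (1 / 2 : ℂ)) *
      ∑' n : ℤ, Complex.exp (π * I * n - 2 * π ^ 2 / t * ((n : ℂ) - (z + r / 2)) ^ 2)) =
      (Complex.exp (-(π * I * z)) * (1 / (t / (2 * π)) ^ (1 / 2 : ℂ)) / Complex.exp (2 * π ^ 2 * z ^ 2 / t)) *
        ∑' n : ℤ, Hn z t n r := by
    intro r
    simp only [Hn, tsum_mul_left, tsum_mul_right]
    field_simp
  simp only [this]
  rw [intervalIntegral.integral_const_mul]
  field_simp

lemma limG {M : ℝ} (hM : 0 ≤ M) {z : ℝ} (hz : 0 < z) (hz' : z < 1 / 4) {w : ℂ} (hw : w = Complex.exp (2 * π * I * z)) :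
    Tendsto (fun t : ℂ => Gt w t * Complex.exp (2 * π ^ 2 * z ^ 2 / t) * (t / (2 * π)) ^ (1 / 2 : ℂ))
      (𝓝[cone M] 0) (𝓝 (Complex.exp (-(π * I * z)) * (1 / 2) * Jz z)) := by
  obtain ⟨C, hC, H⟩ := Hn_sum hM hz hz'
  have h0 : Tendsto (fun t : ℂ => Lam t * ∫ r in (-1 : ℝ)..1, Hn z t 0 r) (𝓝[cone M] 0) (𝓝 (Jz z)) := by
    refine (limK hM hz.le hz' (b := 1) zero_le_one).congr' ?_
    filter_upwards [self_mem_nhdsWithin] with t ht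
    have htn := cone_ne ht
    congr 1
    apply intervalIntegral.integral_congr
    intro r _
    simp only [Hn, f0]
    rw [← Complex.exp_add, div_mul_eq_mul_div, ← Complex.exp_add, ← mul_div_assoc, ← Complex.exp_add]
    congr 2
    rw [Lam]; push_cast; field_simp; ring
  have hrest : Tendsto (fun t : ℂ => Lam t * ((∫ r in (-1 : ℝ)..1, ∑' n : ℤ, Hn z t n r) - ∫ r in (-1 : ℝ)..1, Hn z t 0 r))
      (𝓝[cone M] 0) (𝓝 0) := by
    have hX := tendsto_X hM
    have h1 : Tendsto (fun X : ℝ => (1 + M) * (π / 2) * C * (X ^ 1 * Real.exp (-X))) atTop (𝓝 0) := by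
      simpa using (Real.tendsto_pow_mul_exp_neg_atTop_nhds_zero 1).const_mul ((1 + M) * (π / 2) * C)
    refine squeeze_zero_norm' ?_ (h1.comp hX)
    filter_upwards [self_mem_nhdsWithin, hX.eventually_ge_atTop 1] with t ht hX1
    rw [norm_mul]
    have e1 := cone_norm_le (Lam_cone ht)
    rw [Lam_re] at e1
    have hX0 := (inv_cone ht).1
    calc _ ≤ ((1 + M) * (π / 2 * (t⁻¹).re)) * (C * Real.exp (-(t⁻¹).re)) := by
          apply mul_le_mul e1 (H t ht hX1) (norm_nonneg _) (by positivity)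
      _ = _ := by simp only [Function.comp]; ring
  have hexp : Tendsto (fun t : ℂ => Complex.exp (7 * t / 8)) (𝓝[cone M] 0) (𝓝 1) := by
    have : Continuous (fun t : ℂ => Complex.exp (7 * t / 8)) := by fun_prop
    have := (this.tendsto 0).mono_left (nhdsWithin_le_nhds (s := cone M))
    simpa using this
  have hfin := ((hexp.mul_const (Complex.exp (-(π * I * z)))).mul_const (1 / 2 : ℂ)).mul (h0.add hrest)
  rw [one_mul, add_zero] at hfin
  refine hfin.congr' ?_
  filter_upwards [self_mem_nhdsWithin] with t ht
  rw [Gt_eq2 hM ht hw]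
  ring

def th4 (t : ℂ) : ℂ := ∑' n : ℤ, Complex.exp (-t * (n : ℂ) ^ 2 + π * I * n)

lemma th4_eq {t : ℂ} (ht : 0 < t.re) : th4 t * Complex.exp (π ^ 2 / (4 * t)) * (t / π) ^ (1 / 2 : ℂ) =
    ∑' n : ℤ, Complex.exp (((-(π ^ 2) * ((n : ℝ) ^ 2 - n) : ℝ) : ℂ) * t⁻¹) := by
  have htn : t ≠ 0 := by rintro rfl; simp at ht
  have hpi : (π : ℂ) ≠ 0 := by exact_mod_cast Real.pi_ne_zero
  have ha : 0 < (t / π).re := by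
    rw [Complex.div_ofReal_re]; positivity
  have hc : (t / π) ^ (1 / 2 : ℂ) ≠ 0 := by
    rw [Complex.cpow_def_of_ne_zero (div_ne_zero htn hpi)]; exact Complex.exp_ne_zero _
  have := Complex.tsum_exp_neg_quadratic ha (I / 2)
  have e1 : th4 t = ∑' n : ℤ, Complex.exp (-π * (t / π) * (n : ℂ) ^ 2 + 2 * π * (I / 2) * n) := by
    rw [th4]; apply tsum_congr; intro n; congr 1; field_simp
  rw [e1, this, show ∀ a b c : ℂ, 1 / a * b * c * a = (a / a) * (b * c) by intros; ring, div_self hc, one_mul, ← tsum_mul_right]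
  apply tsum_congr
  intro n
  rw [← Complex.exp_add]
  congr 1
  push_cast
  rw [show (n : ℂ) + I * (I / 2) = n - 1 / 2 by linear_combination (1 / 2) * Complex.I_sq]
  field_simp
  ring

lemma lim_th4 {M : ℝ} (hM : 0 ≤ M) : Tendsto (fun t : ℂ => th4 t * Complex.exp (π ^ 2 / (4 * t)) * (t / π) ^ (1 / 2 : ℂ))
    (𝓝[cone M] 0) (𝓝 2) := by
  have hX := tendsto_X hM
  have hnn : ∀ n : ℤ, (0 : ℝ) ≤ (n : ℝ) ^ 2 - n := by
    intro n
    have : (0 : ℤ) ≤ n ^ 2 - n := by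
      rcases le_or_gt n 0 with h | h <;> nlinarith
    exact_mod_cast this
  have hnb : ∀ n : ℤ, |(n : ℝ)| - 1 ≤ (n : ℝ) ^ 2 - n := by
    intro n
    rcases le_or_gt 0 (n : ℝ) with h | h
    · rw [abs_of_nonneg h]; nlinarith [sq_nonneg ((n : ℝ) - 1)]
    · rw [abs_of_neg h]; nlinarith
  have hnorm : ∀ n : ℤ, ∀ t : ℂ, ‖Complex.exp (((-(π ^ 2) * ((n : ℝ) ^ 2 - n) : ℝ) : ℂ) * t⁻¹)‖ =
      Real.exp (-(π ^ 2 * ((n : ℝ) ^ 2 - n) * (t⁻¹).re)) := by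
    intro n t
    rw [Complex.norm_exp, Complex.re_ofReal_mul]; congr 1; ring
  have key : Tendsto (fun t : ℂ => ∑' n : ℤ, Complex.exp (((-(π ^ 2) * ((n : ℝ) ^ 2 - n) : ℝ) : ℂ) * t⁻¹))
      (𝓝[cone M] 0) (𝓝 (∑' n : ℤ, if n = 0 ∨ n = 1 then (1 : ℂ) else 0)) := by
    apply tendsto_tsum_of_dominated_convergence (bound := fun n : ℤ => Real.exp 1 * Real.exp (-|(n : ℝ)|))
    · exact summable_exp_abs.mul_left _
    · intro n
      split_ifs with h
      · have : (n : ℝ) ^ 2 - n = 0 := by rcases h with h | h <;> rw [h] <;> norm_num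
        rw [this]; simp [tendsto_const_nhds]
      · have hpos : 0 < (n : ℝ) ^ 2 - n := by
          refine lt_of_le_of_ne (hnn n) (fun h0 => h ?_)
          have : (n : ℤ) * (n - 1) = 0 := by
            have : (n : ℝ) * (n - 1) = 0 := by linarith
            exact_mod_cast this
          rcases mul_eq_zero.mp this with h | h
          · left; exact h
          · right; omega
        rw [tendsto_zero_iff_norm_tendsto_zero]
        simp only [hnorm]
        exact Real.tendsto_exp_neg_atTop_nhds_zero.comp (hX.const_mul_atTop (by positivity))
    · filter_upwards [hX.eventually_ge_atTop 1] with t hX1 n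
      rw [hnorm, ← Real.exp_add]
      apply Real.exp_le_exp.mpr
      have h1 := hnn n
      have h2 := hnb n
      have hpi : 1 ≤ π ^ 2 := by nlinarith [Real.pi_gt_three]
      have : 1 * 1 ≤ π ^ 2 * (t⁻¹).re := mul_le_mul hpi hX1 zero_le_one (by positivity)
      nlinarith
  have hs : (∑' n : ℤ, if n = 0 ∨ n = 1 then (1 : ℂ) else 0) = 2 := by
    rw [tsum_eq_sum (s := {0, 1})]
    · rw [Finset.sum_pair (by norm_num)]; norm_num
    · intro n hn; simp at hn; simp [hn]
  rw [hs] at key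
  refine key.congr' ?_
  filter_upwards [self_mem_nhdsWithin] with t ht
  rw [th4_eq ht.1]

lemma lim_Q0 {M : ℝ} (hM : 0 ≤ M) : Tendsto Q0 (𝓝[cone M] 0) (𝓝 1) := by
  have := limK hM (z := 0) le_rfl (by norm_num) (b := 0) le_rfl
  rw [Jz_zero] at this
  refine this.congr fun t => ?_
  simp [Q0]

lemma inv_re_le {M : ℝ} (hM : 0 ≤ M) {t : ℂ} (ht : t ∈ cone M) : 1 / t.re ≤ (1 + M) ^ 2 * (t⁻¹).re := by
  have h0 := ht.1
  have h1 := cone_norm_le ht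
  have hn := norm_pos_iff.mpr (cone_ne ht)
  rw [Complex.inv_re, Complex.normSq_eq_norm_sq, ← mul_div_assoc, div_le_div_iff₀ h0 (by positivity)]
  have := pow_le_pow_left₀ hn.le h1 2
  nlinarith

lemma limF {M : ℝ} (hM : 0 ≤ M) {z : ℝ} (hz : 0 < z) (hz' : z < 1 / 4) {w : ℂ} (hw : w = Complex.exp (2 * π * I * z)) :
    Tendsto (fun t : ℂ => ((1 + w⁻¹) * Vgen w (Complex.exp (-t)) * th4 t) * Complex.exp (2 * π ^ 2 * z ^ 2 / t) * (t / (2 * π)) ^ (1 / 2 : ℂ))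
      (𝓝[cone M] 0) (𝓝 (Complex.exp (-(π * I * z)) * (1 / 2) * Jz z)) := by
  have hQ := lim_Q0 hM
  have hX := tendsto_X hM
  have hG := (hQ.inv₀ one_ne_zero).mul (limG hM hz hz' hw)
  rw [inv_one, one_mul] at hG
  have hwn : ‖w‖ = 1 := by
    rw [hw, show (2 * π * I * z : ℂ) = ((2 * π * z : ℝ) : ℂ) * I by push_cast; ring, Complex.norm_exp_ofReal_mul_I]
  have herr : Tendsto (fun t : ℂ => ((1 + w⁻¹) * Vgen w (Complex.exp (-t)) * th4 t - (Q0 t)⁻¹ * Gt w t) *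
      Complex.exp (2 * π ^ 2 * z ^ 2 / t) * (t / (2 * π)) ^ (1 / 2 : ℂ)) (𝓝[cone M] 0) (𝓝 0) := by
    have h1 : Tendsto (fun X : ℝ => 128 * Real.exp 1 * (1 + M) ^ 4 * (X ^ 2 * Real.exp (-X))) atTop (𝓝 0) := by
      simpa using (Real.tendsto_pow_mul_exp_neg_atTop_nhds_zero 2).const_mul (128 * Real.exp 1 * (1 + M) ^ 4)
    refine squeeze_zero_norm' ?_ (h1.comp hX)
    have hQn : ∀ᶠ t in 𝓝[cone M] 0, 1 / 2 < ‖Q0 t‖ := by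
      have := hQ.norm
      rw [norm_one] at this
      exact this.eventually_const_lt (by norm_num)
    have htn : ∀ᶠ t : ℂ in 𝓝[cone M] 0, ‖t‖ < 1 := by
      have := (tendsto_norm_zero (E := ℂ)).mono_left (nhdsWithin_le_nhds (s := cone M))
      exact this.eventually_lt_const one_pos
    filter_upwards [self_mem_nhdsWithin, hX.eventually_ge_atTop 1, hQn, htn] with t ht hX1 hQ1 ht1
    obtain ⟨p, hp1, hp2, hp3, hp4, hp5⟩ := step1 t w ht.1 hwn
    have hXl : 1 ≤ π * (Lam t).re := by
      rw [Lam_re]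
      nlinarith [Real.pi_gt_three, mul_pos Real.pi_pos Real.pi_pos]
    have hQ0 : Q0 t ≠ 0 := by rw [← norm_pos_iff]; linarith
    have hb := F_bound hM ht hXl hwn hQ0 hp1 hp2 hp3 hp4
    rw [← hp5] at hb
    have hb' : ‖(1 + w⁻¹) * Vgen w (Complex.exp (-t)) * th4 t - (Q0 t)⁻¹ * Gt w t‖ ≤
      16 * Real.exp t.re * Real.exp (-(π ^ 2 / 4) * (t⁻¹).re) / (‖Q0 t‖ * (1 - Real.exp (-t.re)) ^ 2) := hb
    have htre := ht.1
    have htre1 : t.re ≤ 1 := (Complex.re_le_norm t).trans ht1.le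
    have hir := inv_re_le hM ht
    set X := (t⁻¹).re with hXd
    have hX0 : 0 < X := by linarith
    -- lower bound for the denominator
    have hd1 : t.re / 2 ≤ 1 - Real.exp (-t.re) := by
      have h2 := Real.add_one_le_exp t.re
      have h3 : Real.exp (-t.re) ≤ 1 / (1 + t.re) := by
        rw [Real.exp_neg, ← one_div]; exact one_div_le_one_div_of_le (by linarith) (by linarith)
      have h4 : 1 / (1 + t.re) ≤ 1 - t.re / 2 := by
        rw [div_le_iff₀ (by linarith)]; nlinarith
      linarith
    have hd2 : 1 / (2 * (1 + M) ^ 2 * X) ≤ 1 - Real.exp (-t.re) := by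
      refine le_trans ?_ hd1
      rw [div_le_iff₀ htre] at hir
      rw [div_le_iff₀ (by positivity)]
      nlinarith
    have hd3 : 1 / (8 * (1 + M) ^ 4 * X ^ 2) ≤ ‖Q0 t‖ * (1 - Real.exp (-t.re)) ^ 2 := by
      have : (1 / (2 * (1 + M) ^ 2 * X)) ^ 2 ≤ (1 - Real.exp (-t.re)) ^ 2 :=
        pow_le_pow_left₀ (by positivity) hd2 2
      calc _ = 1 / 2 * (1 / (2 * (1 + M) ^ 2 * X)) ^ 2 := by field_simp; norm_num
        _ ≤ _ := mul_le_mul hQ1.le this (by positivity) (norm_nonneg _)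
    have hE : ‖Complex.exp (2 * π ^ 2 * z ^ 2 / t)‖ = Real.exp (2 * π ^ 2 * z ^ 2 * X) := by
      rw [Complex.norm_exp, show (2 * π ^ 2 * z ^ 2 / t : ℂ) = ((2 * π ^ 2 * z ^ 2 : ℝ) : ℂ) * t⁻¹ by push_cast; field_simp,
        Complex.re_ofReal_mul]
    have hS : ‖(t / (2 * π)) ^ (1 / 2 : ℂ)‖ ≤ 1 := by
      rw [show (1 / 2 : ℂ) = ((1 / 2 : ℝ) : ℂ) by push_cast; rfl, Complex.norm_cpow_real]
      apply Real.rpow_le_one (norm_nonneg _) _ (by norm_num)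
      rw [norm_div, show (2 * π : ℂ) = ((2 * π : ℝ) : ℂ) by push_cast; rfl, Complex.norm_real,
        Real.norm_of_nonneg (by positivity), div_le_one (by positivity)]
      linarith [Real.pi_gt_three]
    rw [norm_mul, norm_mul, hE]
    calc _ ≤ 16 * Real.exp t.re * Real.exp (-(π ^ 2 / 4) * X) / (‖Q0 t‖ * (1 - Real.exp (-t.re)) ^ 2) *
          Real.exp (2 * π ^ 2 * z ^ 2 * X) * 1 := by
          apply mul_le_mul _ hS (norm_nonneg _) _
          · exact mul_le_mul_of_nonneg_right hb' (Real.exp_pos _).le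
          · exact mul_nonneg ((norm_nonneg _).trans hb') (Real.exp_pos _).le
      _ ≤ 16 * Real.exp 1 * Real.exp (-(π ^ 2 / 4) * X) / (1 / (8 * (1 + M) ^ 4 * X ^ 2)) *
          Real.exp (2 * π ^ 2 * z ^ 2 * X) := by
          rw [mul_one]
          refine mul_le_mul_of_nonneg_right ?_ (Real.exp_pos _).le
          apply div_le_div₀ (by positivity) _ (by positivity) hd3
          exact mul_le_mul_of_nonneg_right (mul_le_mul_of_nonneg_left (Real.exp_le_exp.mpr htre1) (by norm_num)) (Real.exp_pos _).le
      _ = 128 * Real.exp 1 * (1 + M) ^ 4 * (X ^ 2 * (Real.exp (-(π ^ 2 / 4) * X) * Real.exp (2 * π ^ 2 * z ^ 2 * X))) := by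
          field_simp; norm_num
      _ ≤ _ := by
          simp only [Function.comp]
          refine mul_le_mul_of_nonneg_left (mul_le_mul_of_nonneg_left ?_ (by positivity)) (by positivity)
          rw [← Real.exp_add]
          apply Real.exp_le_exp.mpr
          have hpi : 8 ≤ π ^ 2 := by nlinarith [Real.pi_gt_three]
          have hz2 : z ^ 2 ≤ 1 / 16 := by nlinarith
          have : 1 ≤ π ^ 2 * (1 / 4 - 2 * z ^ 2) := by nlinarith
          nlinarith
  have := herr.add hG
  rw [zero_add] at this
  refine this.congr fun t => ?_
  ring

lemma sqrt_scale {t : ℂ} (ht : t ≠ 0) : (t / π) ^ (1 / 2 : ℂ) = (Real.sqrt 2 : ℂ) * (t / (2 * π)) ^ (1 / 2 : ℂ) := by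
  have hpi : (π : ℂ) ≠ 0 := by exact_mod_cast Real.pi_ne_zero
  have h1 : t / (2 * π) ≠ 0 := div_ne_zero ht (by simp [hpi])
  rw [show t / π = ((2 : ℝ) : ℂ) * (t / (2 * π)) by push_cast; field_simp]
  have h2 : ((2 : ℝ) : ℂ) * (t / (2 * π)) ≠ 0 := mul_ne_zero (by norm_num) h1
  rw [Complex.cpow_def_of_ne_zero h2, Complex.cpow_def_of_ne_zero h1, Complex.log_ofReal_mul (by norm_num) h1,
    add_mul, Complex.exp_add]
  congr 1
  rw [Real.sqrt_eq_rpow, Real.rpow_def_of_pos (by norm_num)]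
  push_cast
  rfl

lemma asymp_t {M : ℝ} (hM : 0 ≤ M) {z : ℝ} (hz : 0 < z) (hz' : z < 1 / 4) {w : ℂ} (hw : w = Complex.exp (2 * π * I * z)) :
    Tendsto (fun t : ℂ => Vgen w (Complex.exp (-t)) /
      ((Real.sqrt 2 / 4 : ℂ) * (Complex.exp (-(π * I * (z : ℂ))) / (1 + w⁻¹)) *
        Complex.exp (π ^ 2 / (4 * t) - 2 * π ^ 2 * z ^ 2 / t) *
        ∫ x : ℝ, Complex.exp (-t * (x : ℂ) ^ 2) * f0 z x)) (𝓝[cone M] 0) (𝓝 1) := by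
  have hJ := Jz_ne hz.le hz'
  have hF := limF hM hz hz' hw
  have hT := lim_th4 hM
  have hm := lim_mordell M hz.le hz'
  have hs2 : (Real.sqrt 2 : ℂ) ≠ 0 := by
    exact_mod_cast (Real.sqrt_pos.mpr (by norm_num : (0:ℝ) < 2)).ne'
  have hw1 : 1 + w⁻¹ ≠ 0 := by
    intro h
    have h1 := congrArg Complex.re h
    rw [hw, ← Complex.exp_neg, show (-(2 * π * I * z) : ℂ) = ((-(2 * π * z) : ℝ) : ℂ) * I by push_cast; ring,
      Complex.add_re, Complex.exp_ofReal_mul_I_re, Real.cos_neg] at h1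
    have := Real.cos_pos_of_mem_Ioo (x := 2 * π * z) ⟨by nlinarith [Real.pi_pos], by nlinarith [Real.pi_pos]⟩
    simp at h1
    linarith
  have hE0 := Complex.exp_ne_zero (-(π * I * (z : ℂ)))
  have h := ((hF.div hT two_ne_zero).mul_const (4 / Complex.exp (-(π * I * (z : ℂ))))).div hm hJ
  rw [show Complex.exp (-(π * I * (z : ℂ))) * (1 / 2) * Jz z / 2 * (4 / Complex.exp (-(π * I * (z : ℂ)))) / Jz z = 1 by
    field_simp; norm_num] at h
  refine h.congr' ?_
  filter_upwards [self_mem_nhdsWithin, hT.eventually_ne two_ne_zero, hm.eventually_ne hJ] with t ht hT0 hm0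
  have htn := cone_ne ht
  simp only [Pi.div_apply]
  rw [sqrt_scale htn] at hT0 ⊢
  have a1 : th4 t ≠ 0 := by intro h; apply hT0; rw [h]; ring
  have a2 : (t / (2 * π)) ^ (1 / 2 : ℂ) ≠ 0 := by intro h; apply hT0; rw [h]; ring
  have a3 := Complex.exp_ne_zero (π ^ 2 / (4 * t))
  have a4 := Complex.exp_ne_zero (2 * π ^ 2 * z ^ 2 / t)
  rw [Complex.exp_sub]
  generalize (t / (2 * π)) ^ (1 / 2 : ℂ) = s at *
  generalize Complex.exp (π ^ 2 / (4 * t)) = E2 at *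
  generalize Complex.exp (2 * π ^ 2 * z ^ 2 / t) = E1 at *
  generalize (∫ x : ℝ, Complex.exp (-t * (x : ℂ) ^ 2) * f0 z x) = m at *
  generalize Complex.exp (-(π * I * (z : ℂ))) = E0 at *
  generalize th4 t = T at *
  field_simp

/-- Lemma 3.2: for `0 < z < 1/4` and `w = e^{2πiz}`, as `τ → 0` in the angular region,
`V(w;q) ~ (√2/4)·(w^{-1/2}/(1+w^{-1}))·q₀^{z²/2-1/16}·h(2z;2τ)`. -/
theorem Vgen_asymp_first_quarter (z : ℝ) (hz₁ : 0 < z) (hz₂ : z < 1 / 4)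
    (w : ℂ) (hw : w = Complex.exp (2 * π * I * (z : ℂ))) (M : ℝ) (hM : 0 < M) :
    Tendsto (fun τ : ℂ => Vgen w (Complex.exp (2 * π * I * τ)) /
      ((Real.sqrt 2 / 4 : ℂ) * (Complex.exp (-(π * I * (z : ℂ))) / (1 + w⁻¹)) *
        Complex.exp (-2 * π * I * ((z ^ 2 / 2 - 1 / 16 : ℝ) : ℂ) / τ) *
        mordell (2 * z) (2 * τ)))
      (nhdsWithin 0 (angleRegion M)) (nhds 1) := by
  have h := asymp_t hM.le hz₁ hz₂ hw
  have hpi : (π : ℂ) ≠ 0 := by exact_mod_cast Real.pi_ne_zero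
  have hmap : Tendsto (fun τ : ℂ => -(2 * π * I * τ)) (nhdsWithin 0 (angleRegion M)) (𝓝[cone M] 0) := by
    rw [tendsto_nhdsWithin_iff]
    constructor
    · have : Continuous (fun τ : ℂ => -(2 * π * I * τ)) := by fun_prop
      have := (this.tendsto 0).mono_left (nhdsWithin_le_nhds (s := angleRegion M))
      simpa using this
    · filter_upwards [self_mem_nhdsWithin] with τ hτ
      have e1 : (-(2 * π * I * τ)).re = 2 * π * τ.im := by simp
      have e2 : (-(2 * π * I * τ)).im = -(2 * π * τ.re) := by simp
      refine ⟨?_, ?_⟩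
      · rw [e1]; have := hτ.1; positivity
      · rw [e1, e2, abs_neg, abs_mul, abs_of_pos (by positivity : 0 < 2 * π)]
        have := mul_le_mul_of_nonneg_left hτ.2 (by positivity : 0 ≤ 2 * π)
        linarith
  refine (h.comp hmap).congr' ?_
  filter_upwards [self_mem_nhdsWithin] with τ hτ
  have hτ0 : τ ≠ 0 := by rintro rfl; have := hτ.1; simp at this
  simp only [Function.comp]
  rw [neg_neg]
  have hI : mordell (2 * z) (2 * τ) = ∫ x : ℝ, Complex.exp (2 * π * I * τ * (x : ℂ) ^ 2) * f0 z x := by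
    rw [mordell]
    congr 1
    funext x
    rw [f0, ← mul_div_assoc, ← Complex.exp_add]
    congr 2
    push_cast; ring
  have hX : (π ^ 2 / (4 * -(2 * π * I * τ)) - 2 * π ^ 2 * z ^ 2 / -(2 * π * I * τ) : ℂ) =
      -2 * π * I * ((z ^ 2 / 2 - 1 / 16 : ℝ) : ℂ) / τ := by
    push_cast
    field_simp
    linear_combination (-(16 : ℂ) + 128 * z ^ 2) * Complex.I_sq
  rw [hI, hX]
end
end

section
/- Define T(1;q) := −(ϑ(1/2;τ)/ϑ(τ;2τ))·μ(1/2, 1/2; 2τ). Then, as τ → 0 in ℍ with |Re τ| ≤ M·Im τ for some fixed M > 0, T(1;q) ~ (√2/4)·q₀^{−1/16}, i.e. T(1;q)·e^{−πi/(8τ)} → √2/4. -/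
open Complex Real Filter Topology

noncomputable section

lemma aux_theta_lim (c : ℤ → ℂ) (a : ℤ → ℤ) (hc : ∀ n, ‖c n‖ ≤ 1) (ha : ∀ n, 0 ≤ a n)
    (hs : Summable fun n : ℤ => Real.exp (-π * a n)) :
    Tendsto (fun s : ℂ => ∑' n : ℤ, c n * cexp (π * I * a n * s)) (comap Complex.im atTop)
      (nhds (∑' n : ℤ, if a n = 0 then c n else 0)) := by
  have hn : ∀ (n : ℤ) (s : ℂ), ‖cexp (π * I * a n * s)‖ = Real.exp (-π * a n * s.im) := by
    intro n s
    rw [Complex.norm_exp]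
    congr 1
    have : (π : ℂ) * I * a n * s = ((π * a n : ℝ) : ℂ) * s * I := by push_cast; ring
    rw [this, mul_I_re, im_ofReal_mul]
    ring
  refine tendsto_tsum_of_dominated_convergence (bound := fun n => Real.exp (-π * a n)) hs ?_ ?_
  · intro n
    by_cases h0 : a n = 0
    · simpa [h0] using tendsto_const_nhds
    · rw [if_neg h0]
      have hpos : 0 < (a n : ℝ) := by
        have := ha n
        exact_mod_cast lt_of_le_of_ne this (Ne.symm h0)
      have h1 : Tendsto (fun s : ℂ => cexp (π * I * a n * s)) (comap Complex.im atTop) (nhds 0) := by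
        rw [tendsto_zero_iff_norm_tendsto_zero]
        simp_rw [hn]
        have h2 : Tendsto (fun x : ℝ => Real.exp (-π * a n * x)) atTop (nhds 0) := by
          apply Real.tendsto_exp_atBot.comp
          apply Tendsto.const_mul_atTop_of_neg _ tendsto_id
          have := mul_pos Real.pi_pos hpos
          linarith
        exact h2.comp tendsto_comap
      simpa using h1.const_mul (c n)
  · have : ∀ᶠ s : ℂ in comap Complex.im atTop, 1 ≤ s.im :=
      tendsto_comap.eventually (eventually_ge_atTop (1 : ℝ))
    filter_upwards [this] with s hs1 n
    rw [norm_mul, hn]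
    have h3 : Real.exp (-π * a n * s.im) ≤ Real.exp (-π * a n) := by
      apply Real.exp_le_exp.mpr
      have h4 : 0 ≤ π * (a n : ℝ) := mul_nonneg Real.pi_pos.le (by exact_mod_cast ha n)
      nlinarith
    calc _ ≤ 1 * Real.exp (-π * a n * s.im) := by gcongr; exact hc n
      _ ≤ _ := by rw [one_mul]; exact h3

lemma aux_summable (T : ℝ) (hT : 0 < T) : Summable fun n : ℤ => Real.exp (-π * T * (n : ℝ) ^ 2) := by
  have := summable_pow_mul_jacobiTheta₂_term_bound 0 hT 0
  refine this.congr fun n => ?_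
  simp only [pow_zero, one_mul]
  congr 1
  ring

lemma aux_summable2 : Summable fun n : ℤ => Real.exp (-π * ((n ^ 2 - n : ℤ) : ℝ)) := by
  have := summable_pow_mul_jacobiTheta₂_term_bound (1 / 2) (T := 1) one_pos 0
  refine this.of_nonneg_of_le (fun n => (Real.exp_pos _).le) fun n => ?_
  simp only [pow_zero, one_mul]
  apply Real.exp_le_exp.mpr
  push_cast
  have := le_abs_self (n : ℝ)
  nlinarith [Real.pi_pos]

lemma aux_lim_zero :
    Tendsto (fun s : ℂ => jacobiTheta₂ 0 s) (comap Complex.im atTop) (nhds 1) := by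
  have := aux_theta_lim (fun _ => 1) (fun n => n ^ 2) (by simp) (fun n => sq_nonneg n)
    (by simpa using aux_summable 1 one_pos)
  convert this using 2
  · rw [jacobiTheta₂]
    refine tsum_congr fun n => ?_
    rw [jacobiTheta₂_term]
    push_cast
    simp
  · simp

lemma aux_exp_int (n : ℤ) : cexp (π * I * n) = (-1 : ℂ) ^ n := by
  rw [← Complex.exp_pi_mul_I, ← Complex.exp_int_mul]
  congr 1
  ring

lemma aux_lim_half :
    Tendsto (fun s : ℂ => jacobiTheta₂ (1 / 2) s) (comap Complex.im atTop) (nhds 1) := by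
  have := aux_theta_lim (fun n => (-1 : ℂ) ^ n) (fun n => n ^ 2) (by simp) (fun n => sq_nonneg n)
    (by simpa using aux_summable 1 one_pos)
  convert this using 2
  · rw [jacobiTheta₂]
    refine tsum_congr fun n => ?_
    rw [jacobiTheta₂_term, Complex.exp_add, ← aux_exp_int]
    push_cast
    congr 2
    ring
  · rw [tsum_eq_single 0]
    · simp
    · intro n hn
      simp [hn]

lemma aux_lim_two :
    Tendsto (fun s : ℂ => jacobiTheta₂ (-s / 2) s) (comap Complex.im atTop) (nhds 2) := by
  have := aux_theta_lim (fun _ => 1) (fun n => n ^ 2 - n) (by simp)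
    (fun n => by
      rcases le_or_gt n 0 with h | h
      · nlinarith
      · have : 1 ≤ n := h
        nlinarith)
    aux_summable2
  convert this using 2
  · rw [jacobiTheta₂]
    refine tsum_congr fun n => ?_
    rw [jacobiTheta₂_term, one_mul]
    push_cast
    congr 1
    ring
  · rw [tsum_eq_sum (s := {0, 1})]
    · rw [Finset.sum_pair (by norm_num)]
      norm_num
    · intro n hn
      have h : n ^ 2 - n = n * (n - 1) := by ring
      simp only [Finset.mem_insert, Finset.mem_singleton, not_or] at hn
      rw [if_neg]
      rw [h]
      exact mul_ne_zero hn.1 (sub_ne_zero.mpr hn.2)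

lemma aux_cosh_ge (w : ℂ) : |w.re| ≤ ‖Complex.cosh w‖ := by
  have h1 : |w.re| ≤ |Real.sinh w.re| := by
    rw [Real.abs_sinh]
    exact Real.self_le_sinh_iff.mpr (abs_nonneg _)
  have h2 : |Real.sinh w.re| ≤ ‖Complex.cosh w‖ := by
    rw [Complex.cosh, Real.sinh_eq, norm_div, abs_div]
    have := abs_norm_sub_norm_le (cexp w) (-cexp (-w))
    rw [norm_neg, Complex.norm_exp, Complex.norm_exp, sub_neg_eq_add, Complex.neg_re] at this
    simp only [Complex.norm_ofNat, Nat.abs_ofNat]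
    gcongr
  exact h1.trans h2

lemma aux_sech (K : ℝ) (hK : 1 ≤ K) (w : ℂ) (hw : ‖w‖ ≤ K * |w.re|) :
    ‖1 / Complex.cosh w - 1‖ ≤ (2 + 4 * K) * ‖w‖ := by
  rcases le_total ‖w‖ (1 / 2) with h | h
  · have h1 : ‖Complex.cosh w - 1‖ ≤ ‖w‖ ^ 2 := by
      have e : Complex.cosh w - 1 = ((cexp w - 1 - w) + (cexp (-w) - 1 - (-w))) / 2 := by
        rw [Complex.cosh]; ring
      have a1 := Complex.norm_exp_sub_one_sub_id_le (x := w) (by linarith)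
      have a2 := Complex.norm_exp_sub_one_sub_id_le (x := -w) (by rw [norm_neg]; linarith)
      rw [norm_neg] at a2
      rw [e, norm_div, Complex.norm_ofNat]
      have := norm_add_le (cexp w - 1 - w) (cexp (-w) - 1 - (-w))
      linarith
    have h2 : 1 / 2 ≤ ‖Complex.cosh w‖ := by
      have := norm_sub_norm_le (1 : ℂ) (1 - Complex.cosh w)
      rw [norm_one, sub_sub_cancel, norm_sub_rev] at this
      nlinarith [norm_nonneg w]
    have h0 : Complex.cosh w ≠ 0 := by
      intro h0; rw [h0] at h2; norm_num at h2
    have e2 : 1 / Complex.cosh w - 1 = -(Complex.cosh w - 1) / Complex.cosh w := by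
      field_simp; ring
    rw [e2, norm_div, norm_neg, div_le_iff₀ (by linarith)]
    have := norm_nonneg w
    calc _ ≤ ‖w‖ ^ 2 := h1
      _ ≤ ‖w‖ * (1 / 2) := by nlinarith
      _ ≤ (2 + 4 * K) * ‖w‖ * (1 / 2) := by nlinarith
      _ ≤ _ := by gcongr
  · have h1 := aux_cosh_ge w
    have h2 : 1 / (2 * K) ≤ ‖Complex.cosh w‖ := by
      refine le_trans ?_ h1
      rw [div_le_iff₀ (by linarith)]
      linarith
    have h3 : ‖1 / Complex.cosh w‖ ≤ 2 * K := by
      rw [norm_div, norm_one]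
      rw [one_div_le (lt_of_lt_of_le (by positivity) h2) (by linarith)]
      exact h2
    have h4 := norm_sub_le (1 / Complex.cosh w) 1
    rw [norm_one] at h4
    nlinarith

/-- the symmetrized Appell sum -/
def auxS (τ : ℂ) : ℂ := ∑' n : ℤ, cexp (2 * π * I * n ^ 2 * τ) * (1 / (2 * Complex.cosh (2 * π * I * n * τ)))

lemma aux_appell (τ : ℂ) : appell (1 / 2) (1 / 2) (2 * τ) = I * auxS τ := by
  rw [appell, auxS]
  congr 1
  · rw [show (π : ℂ) * I * (1 / 2) = π / 2 * I by ring, Complex.exp_pi_div_two_mul_I]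
  · refine tsum_congr fun n => ?_
    have e1 : cexp (2 * π * I * (1 / 2)) = -1 := by
      rw [show 2 * (π : ℂ) * I * (1 / 2) = π * I by ring, Complex.exp_pi_mul_I]
    have e2 : cexp (2 * π * I * n * (1 / 2)) = (-1 : ℂ) ^ n := by
      rw [← aux_exp_int]; congr 1; ring
    have e3 : cexp (π * I * n * (n + 1) * (2 * τ)) =
        cexp (2 * π * I * n ^ 2 * τ) * cexp (2 * π * I * n * τ) := by
      rw [← Complex.exp_add]; congr 1; ring
    have e4 : cexp (2 * π * I * n * (2 * τ)) =
        cexp (2 * π * I * n * τ) * cexp (2 * π * I * n * τ) := by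
      rw [← Complex.exp_add]; congr 1; ring
    have e5 : (-1 : ℂ) ^ n * (-1 : ℂ) ^ n = 1 := by
      rw [← mul_zpow]; simp
    rw [e1, e2, e3, e4, e5, Complex.cosh, Complex.exp_neg]
    have h0 := Complex.exp_ne_zero (2 * π * I * n * τ)
    generalize cexp (2 * π * I * n * τ) = W at *
    generalize cexp (2 * π * I * n ^ 2 * τ) = V at *
    have e6 : 1 - -1 * (W * W) = W * (2 * ((W + W⁻¹) / 2)) := by field_simp; ring
    rw [e6, one_mul, mul_div_assoc, one_div]
    congr 1
    rw [div_eq_mul_inv, mul_inv, ← mul_assoc, mul_inv_cancel₀ h0, one_mul]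

lemma aux_jt_half (τ : ℂ) (hτ : 0 < τ.im) :
    jtheta (1 / 2) τ = -(1 / (-I * τ) ^ (1 / 2 : ℂ) * jacobiTheta₂ (1 / 2) (-1 / τ)) := by
  have hne : τ ≠ 0 := by rintro rfl; simp at hτ
  have h := jacobiTheta₂_functional_equation (τ / 2) τ
  have e1 : jtheta (1 / 2) τ = -(cexp (π * I * τ / 4) * jacobiTheta₂ (τ / 2) τ) := by
    rw [jtheta, jacobiTheta₂, ← tsum_mul_left, ← tsum_neg]
    refine tsum_congr fun n => ?_
    rw [jacobiTheta₂_term, ← Complex.exp_add]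
    have : π * I * ((n : ℂ) + 1 / 2) ^ 2 * τ + 2 * π * I * ((n : ℂ) + 1 / 2) * (1 / 2 + 1 / 2)
      = (π * I * τ / 4 + (2 * π * I * n * (τ / 2) + π * I * n ^ 2 * τ)) + (n : ℂ) * (2 * π * I)
        + π * I := by ring
    rw [this, Complex.exp_add, Complex.exp_add, Complex.exp_int_mul_two_pi_mul_I,
      Complex.exp_pi_mul_I]
    ring
  rw [e1, h]
  have e2 : cexp (-π * I * (τ / 2) ^ 2 / τ) = cexp (-(π * I * τ / 4)) := by
    congr 1; field_simp; ring
  have e3 : τ / 2 / τ = 1 / 2 := by field_simp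
  rw [e2, e3, Complex.exp_neg]
  have := Complex.exp_ne_zero (π * I * τ / 4)
  field_simp

lemma aux_jt_tau (τ : ℂ) (hτ : 0 < τ.im) :
    jtheta τ (2 * τ) = -I * cexp (-(π * I * τ / 2)) * (1 / (-I * (2 * τ)) ^ (1 / 2 : ℂ) *
      cexp (-(π * I) / (8 * τ)) * jacobiTheta₂ (-(-1 / (2 * τ)) / 2) (-1 / (2 * τ))) := by
  have hne : τ ≠ 0 := by rintro rfl; simp at hτ
  have h := jacobiTheta₂_functional_equation (1 / 2) (2 * τ)
  have e1 : jtheta τ (2 * τ) = -I * cexp (-(π * I * τ / 2)) * jacobiTheta₂ (1 / 2) (2 * τ) := by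
    rw [jtheta, jacobiTheta₂, ← tsum_mul_left, ← (Equiv.subRight (1 : ℤ)).tsum_eq]
    refine tsum_congr fun n => ?_
    rw [jacobiTheta₂_term, Equiv.subRight_apply]
    push_cast
    have : π * I * ((n : ℂ) - 1 + 1 / 2) ^ 2 * (2 * τ) +
        2 * π * I * ((n : ℂ) - 1 + 1 / 2) * (τ + 1 / 2)
      = -(π / 2 * I) + (-(π * I * τ / 2) + (2 * π * I * n * (1 / 2) + π * I * n ^ 2 * (2 * τ)))
        := by ring
    rw [this, Complex.exp_add, Complex.exp_add, Complex.exp_neg (π / 2 * I),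
      Complex.exp_pi_div_two_mul_I, Complex.inv_I]
    ring
  rw [e1, h]
  have e2 : -π * I * (1 / 2) ^ 2 / (2 * τ) = -(π * I) / (8 * τ) := by
    field_simp; ring
  have e3 : (1 / 2) / (2 * τ) = -(-1 / (2 * τ)) / 2 := by field_simp
  rw [e2, e3]

lemma aux_gauss : ∃ C : ℝ, 0 ≤ C ∧ ∀ y : ℝ, 0 < y → y ≤ 1 →
    (∑' n : ℤ, Real.exp (-π * y * (n : ℝ) ^ 2)) ≤ C / Real.sqrt y := by
  refine ⟨∑' n : ℤ, Real.exp (-π * 1 * (n : ℝ) ^ 2), tsum_nonneg fun n => (Real.exp_pos _).le, ?_⟩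
  intro y hy hy1
  rw [Real.tsum_exp_neg_mul_int_sq hy, ← Real.sqrt_eq_rpow, one_div, mul_comm, ← div_eq_mul_inv]
  have hy2 : 1 ≤ 1 / y := by rw [le_div_iff₀ hy]; linarith
  have hs : Summable fun n : ℤ => Real.exp (-π / y * (n : ℝ) ^ 2) := by
    refine (aux_summable (1 / y) (by positivity)).congr fun n => ?_
    congr 1; ring
  gcongr ?_ / _
  refine hs.tsum_le_tsum (fun n => ?_) (aux_summable 1 one_pos)
  apply Real.exp_le_exp.mpr
  have : -π / y = -π * (1 / y) := by ring
  rw [this]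
  have := mul_nonneg Real.pi_pos.le (sq_nonneg (n : ℝ))
  nlinarith

lemma aux_S_err (K : ℝ) (hK : 1 ≤ K) : ∃ C : ℝ, ∀ τ : ℂ, 0 < τ.im → τ.im ≤ 1 → ‖τ‖ ≤ K * τ.im →
    ‖auxS τ - jacobiTheta₂ 0 (2 * τ) / 2‖ ≤ C := by
  obtain ⟨C, hC0, hC⟩ := aux_gauss
  refine ⟨(2 + 4 * K) * π * K * C, fun τ hτ hτ1 hτK => ?_⟩
  set y := τ.im with hy
  have hsum0 := (hasSum_jacobiTheta₂_term 0 (τ := 2 * τ) (by simpa using hτ)).div_const 2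
  have hsy : 0 < Real.sqrt y := Real.sqrt_pos.mpr hτ
  have key : ∀ n : ℤ, ‖cexp (2 * π * I * n ^ 2 * τ) * (1 / (2 * Complex.cosh (2 * π * I * n * τ)))
      - jacobiTheta₂_term n 0 (2 * τ) / 2‖ ≤
      (2 + 4 * K) * π * K * Real.sqrt y * Real.exp (-π * y * (n : ℝ) ^ 2) := by
    intro n
    have e1 : jacobiTheta₂_term n 0 (2 * τ) = cexp (2 * π * I * n ^ 2 * τ) := by
      rw [jacobiTheta₂_term]; congr 1; ring
    have e2 : cexp (2 * π * I * n ^ 2 * τ) * (1 / (2 * Complex.cosh (2 * π * I * n * τ)))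
      - jacobiTheta₂_term n 0 (2 * τ) / 2 = jacobiTheta₂_term n 0 (2 * τ) *
        (1 / Complex.cosh (2 * π * I * n * τ) - 1) / 2 := by
      rw [e1, one_div, mul_inv]; ring
    have hw : 2 * π * I * n * τ = ((2 * π * n : ℝ) : ℂ) * τ * I := by push_cast; ring
    have hre : |(2 * π * I * n * τ).re| = 2 * π * |(n : ℝ)| * y := by
      rw [hw, mul_I_re, im_ofReal_mul, abs_neg, abs_mul, abs_mul, abs_mul, abs_of_pos hτ,
        abs_of_pos Real.pi_pos]
      simp
    have hno : ‖2 * π * I * n * τ‖ = 2 * π * |(n : ℝ)| * ‖τ‖ := by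
      rw [hw, norm_mul, norm_mul, Complex.norm_I, Complex.norm_real, Real.norm_eq_abs, abs_mul,
        abs_mul, abs_of_pos Real.pi_pos]
      simp
    have hn0 : 0 ≤ 2 * π * |(n : ℝ)| := by positivity
    have hs := aux_sech K hK (2 * π * I * n * τ) (by
      rw [hre, hno]
      nlinarith)
    rw [hno] at hs
    rw [e2, norm_div, norm_mul, norm_jacobiTheta₂_term, Complex.norm_ofNat]
    have him : (2 * τ).im = 2 * y := by simp [hy]
    rw [him]
    have hexp : Real.exp (-π * n ^ 2 * (2 * y) - 2 * π * n * (0 : ℂ).im) =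
        Real.exp (-π * y * (n : ℝ) ^ 2) * Real.exp (-(π * y * (n : ℝ) ^ 2)) := by
      rw [← Real.exp_add]; congr 1; simp; ring
    rw [hexp]
    have hu : |(n : ℝ)| * Real.sqrt y * Real.exp (-(π * y * (n : ℝ) ^ 2)) ≤ 1 := by
      rw [Real.exp_neg, ← div_eq_mul_inv, div_le_one (Real.exp_pos _)]
      set u := |(n : ℝ)| * Real.sqrt y with hu
      have hu2 : u ^ 2 = y * (n : ℝ) ^ 2 := by
        rw [hu, mul_pow, Real.sq_sqrt hτ.le, sq_abs]; ring
      rw [mul_assoc, ← hu2]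
      have := Real.add_one_le_exp (π * u ^ 2)
      nlinarith [Real.pi_gt_three, sq_nonneg (u - 1), sq_nonneg u]
    have hy' : y = Real.sqrt y * Real.sqrt y := (Real.mul_self_sqrt hτ.le).symm
    set G := Real.exp (-π * y * (n : ℝ) ^ 2)
    set H := Real.exp (-(π * y * (n : ℝ) ^ 2))
    have hG : 0 < G := Real.exp_pos _
    have hH : 0 < H := Real.exp_pos _
    calc G * H * ‖1 / Complex.cosh (2 * π * I * n * τ) - 1‖ / 2
        ≤ G * H * ((2 + 4 * K) * (2 * π * |(n : ℝ)| * ‖τ‖)) / 2 := by gcongr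
      _ ≤ G * H * ((2 + 4 * K) * (2 * π * |(n : ℝ)| * (K * y))) / 2 := by gcongr
      _ = (2 + 4 * K) * π * K * G * (|(n : ℝ)| * y * H) := by ring
      _ = (2 + 4 * K) * π * K * Real.sqrt y * G * (|(n : ℝ)| * Real.sqrt y * H) := by
          nth_rewrite 1 [hy']; ring
      _ ≤ (2 + 4 * K) * π * K * Real.sqrt y * G * 1 := by gcongr
      _ = _ := by ring
  have hbs : Summable fun n : ℤ =>
      (2 + 4 * K) * π * K * Real.sqrt y * Real.exp (-π * y * (n : ℝ) ^ 2) :=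
    (aux_summable y hτ).mul_left _
  have hd := Summable.of_norm_bounded hbs key
  have hS : Summable fun n : ℤ =>
      cexp (2 * π * I * n ^ 2 * τ) * (1 / (2 * Complex.cosh (2 * π * I * n * τ))) := by
    refine (hd.add hsum0.summable).congr fun n => ?_
    ring
  have e : auxS τ - jacobiTheta₂ 0 (2 * τ) / 2 = ∑' n : ℤ,
      (cexp (2 * π * I * n ^ 2 * τ) * (1 / (2 * Complex.cosh (2 * π * I * n * τ)))
      - jacobiTheta₂_term n 0 (2 * τ) / 2) := by
    rw [hS.tsum_sub hsum0.summable, hsum0.tsum_eq, auxS]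
  rw [e]
  refine (tsum_of_norm_bounded hbs.hasSum key).trans ?_
  rw [tsum_mul_left]
  have hK0 : 0 < (2 + 4 * K) * π * K := by positivity
  calc _ ≤ (2 + 4 * K) * π * K * Real.sqrt y * (C / Real.sqrt y) := by
        gcongr; exact hC y hτ hτ1
    _ = _ := by field_simp

lemma aux_norm_le (M : ℝ) (hM : 0 < M) (τ : ℂ) (h : τ ∈ angleRegion M) : ‖τ‖ ≤ (1 + M) * τ.im := by
  have := Complex.norm_le_abs_re_add_abs_im τ
  rw [abs_of_pos h.1] at this
  linarith [h.2]

lemma aux_tendsto_im (M : ℝ) (hM : 0 < M) (a : ℝ) (ha : 0 < a) :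
    Tendsto (fun τ : ℂ => -1 / ((a : ℂ) * τ)) (nhdsWithin 0 (angleRegion M))
      (comap Complex.im atTop) := by
  rw [tendsto_comap_iff]
  have h1 : Tendsto (fun τ : ℂ => ‖τ‖) (nhdsWithin 0 (angleRegion M)) (nhdsWithin 0 (Set.Ioi 0)) := by
    rw [tendsto_nhdsWithin_iff]
    constructor
    · have : Tendsto (fun τ : ℂ => ‖τ‖) (nhds 0) (nhds 0) := by
        simpa using (continuous_norm (E := ℂ)).tendsto 0
      exact this.mono_left nhdsWithin_le_nhds
    · filter_upwards [self_mem_nhdsWithin] with τ hτ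
      have : τ ≠ 0 := by rintro rfl; simpa using hτ.1
      simpa using this
  have h2 := (tendsto_inv_nhdsGT_zero.comp h1).const_mul_atTop
    (show 0 < (a * (1 + M))⁻¹ by positivity)
  refine tendsto_atTop_mono' _ ?_ h2
  filter_upwards [self_mem_nhdsWithin] with τ hτ
  have hne : τ ≠ 0 := by rintro rfl; simpa using hτ.1
  have hp : 0 < ‖τ‖ := norm_pos_iff.mpr hne
  have hb := aux_norm_le M hM τ hτ
  have e : (-1 / ((a : ℂ) * τ)).im = τ.im / (a * ‖τ‖ ^ 2) := by
    have : -1 / ((a : ℂ) * τ) = ((-a⁻¹ : ℝ) : ℂ) * τ⁻¹ := by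
      push_cast; field_simp
    rw [this, im_ofReal_mul, Complex.inv_im, Complex.normSq_eq_norm_sq]
    field_simp
  simp only [Function.comp]
  rw [e, ← mul_inv, inv_eq_one_div, div_le_div_iff₀ (by positivity) (by positivity)]
  have := mul_le_mul_of_nonneg_left hb (show 0 ≤ a * ‖τ‖ by positivity)
  nlinarith

lemma aux_cpow_sq (z : ℂ) : (z ^ (1 / 2 : ℂ)) ^ 2 = z := by
  have := Complex.cpow_nat_inv_pow z (n := 2) two_ne_zero
  simpa using this

lemma aux_g_tendsto : Tendsto (fun τ : ℂ => (-I * (2 * τ)) ^ (1 / 2 : ℂ)) (nhds 0) (nhds 0) := by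
  rw [tendsto_zero_iff_norm_tendsto_zero]
  have e : ∀ τ : ℂ, ‖(-I * (2 * τ)) ^ (1 / 2 : ℂ)‖ = Real.sqrt (2 * ‖τ‖) := by
    intro τ
    have := congrArg norm (aux_cpow_sq (-I * (2 * τ)))
    rw [norm_pow] at this
    rw [← Real.sqrt_sq (norm_nonneg ((-I * (2 * τ)) ^ (1 / 2 : ℂ))), this]
    simp
  simp_rw [e]
  have : Continuous fun τ : ℂ => Real.sqrt (2 * ‖τ‖) := by fun_prop
  simpa using this.tendsto 0

lemma aux_S_lim (M : ℝ) (hM : 0 < M) :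
    Tendsto (fun τ : ℂ => (-I * (2 * τ)) ^ (1 / 2 : ℂ) * auxS τ) (nhdsWithin 0 (angleRegion M))
      (nhds (1 / 2)) := by
  obtain ⟨C, hC⟩ := aux_S_err (1 + M) (by linarith)
  have hg := aux_g_tendsto.mono_left (nhdsWithin_le_nhds (s := angleRegion M))
  have hth := (aux_lim_zero.comp (aux_tendsto_im M hM 2 two_pos)).div_const 2
  have hd : Tendsto (fun τ : ℂ => (-I * (2 * τ)) ^ (1 / 2 : ℂ) *
      (auxS τ - jacobiTheta₂ 0 (2 * τ) / 2)) (nhdsWithin 0 (angleRegion M)) (nhds 0) := by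
    refine hg.zero_mul_isBoundedUnder_le ?_
    refine isBoundedUnder_of_eventually_le (a := C) ?_
    have him : ∀ᶠ τ : ℂ in nhdsWithin 0 (angleRegion M), τ.im < 1 := by
      apply nhdsWithin_le_nhds
      exact (Complex.continuous_im.tendsto 0).eventually (gt_mem_nhds (by simp))
    filter_upwards [self_mem_nhdsWithin, him] with τ hτ h1
    exact hC τ hτ.1 h1.le (aux_norm_le M hM τ hτ)
  have := hd.add hth
  rw [zero_add] at this
  refine this.congr' ?_
  filter_upwards [self_mem_nhdsWithin] with τ hτ
  have hne : τ ≠ 0 := by rintro rfl; simpa using hτ.1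
  have h := jacobiTheta₂_functional_equation 0 (2 * τ)
  have hg0 : (-I * (2 * τ)) ^ (1 / 2 : ℂ) ≠ 0 := by
    intro h0
    have := aux_cpow_sq (-I * (2 * τ))
    rw [h0] at this
    simp at this
    exact hne this
  rw [h]
  simp only [Function.comp]
  push_cast
  have : cexp (-π * I * 0 ^ 2 / (2 * τ)) = 1 := by simp
  rw [this, zero_div]
  field_simp
  ring

lemma aux_g_ratio (τ : ℂ) (hτ : 0 < τ.im) : (-I * (2 * τ)) ^ (1 / 2 : ℂ) =
    (Real.sqrt 2 : ℂ) * (-I * τ) ^ (1 / 2 : ℂ) := by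
  have : -I * (2 * τ) = ((2 : ℝ) : ℂ) * (-I * τ) := by push_cast; ring
  have hne : -I * τ ≠ 0 := by
    refine mul_ne_zero (neg_ne_zero.mpr Complex.I_ne_zero) ?_
    rintro rfl
    simp at hτ
  have h2 : ((2 : ℝ) : ℂ) ≠ 0 := by norm_num
  rw [this, Complex.cpow_def_of_ne_zero (mul_ne_zero h2 hne), Complex.log_ofReal_mul two_pos hne,
    add_mul, Complex.exp_add, ← Complex.cpow_def_of_ne_zero hne, Real.sqrt_eq_rpow,
    Real.rpow_def_of_pos two_pos]
  push_cast
  rfl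

/-- Eq. (3.5): with `T(1;q) = -(ϑ(1/2;τ)/ϑ(τ;2τ))·μ(1/2,1/2;2τ)`, one has
`T(1;q) ~ (√2/4)·q₀^{-1/16}` as `τ → 0` in an angular region. -/
theorem T_one_asymp (M : ℝ) (hM : 0 < M) :
    Tendsto (fun τ : ℂ =>
      -(jtheta (1 / 2) τ / jtheta τ (2 * τ)) * mu (1 / 2) (1 / 2) (2 * τ) *
        Complex.exp (-(π * I) / (8 * τ)))
      (nhdsWithin 0 (angleRegion M)) (nhds ((Real.sqrt 2 / 4 : ℝ) : ℂ)) := by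
  have l1 := aux_lim_half.comp (aux_tendsto_im M hM 1 one_pos)
  have l2 := aux_lim_half.comp (aux_tendsto_im M hM 2 two_pos)
  have l3 := aux_lim_two.comp (aux_tendsto_im M hM 2 two_pos)
  have l4 := aux_S_lim M hM
  have l5 : Tendsto (fun τ : ℂ => cexp (π * I * τ / 2)) (nhdsWithin 0 (angleRegion M)) (nhds 1) := by
    have : Continuous fun τ : ℂ => cexp (π * I * τ / 2) := by fun_prop
    have h := this.tendsto 0
    simp only [mul_zero, zero_div, Complex.exp_zero] at h
    exact h.mono_left nhdsWithin_le_nhds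
  have L := ((((l1.mul l4).mul l5).const_mul (Real.sqrt 2 : ℂ)).div (l3.mul l2) (by norm_num))
  have e : ((Real.sqrt 2 / 4 : ℝ) : ℂ) = (Real.sqrt 2 : ℂ) * (1 * (1 / 2) * 1) / (2 * 1) := by
    push_cast; ring
  rw [e]
  refine L.congr' ?_
  filter_upwards [self_mem_nhdsWithin] with τ hτ
  have hτ0 : 0 < τ.im := hτ.1
  have hne : τ ≠ 0 := by rintro rfl; simp at hτ0
  have hj := aux_jt_half (2 * τ) (by simpa using hτ0)
  rw [mu, aux_appell, hj, aux_jt_half τ hτ0, aux_jt_tau τ hτ0]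
  simp only [Function.comp, Pi.div_apply]
  push_cast
  rw [aux_g_ratio τ hτ0, one_mul, Complex.exp_neg]
  have hE := Complex.exp_ne_zero (π * I * τ / 2)
  have hF := Complex.exp_ne_zero (-(π * I) / (8 * τ))
  have hg0 : (-I * τ) ^ (1 / 2 : ℂ) ≠ 0 := by
    intro h0
    have := aux_cpow_sq (-I * τ)
    rw [h0] at this
    simp at this
    exact hne this
  have hs : (Real.sqrt 2 : ℂ) ≠ 0 := by simp
  generalize jacobiTheta₂ (-(-1 / (2 * τ)) / 2) (-1 / (2 * τ)) = X
  generalize jacobiTheta₂ (1 / 2) (-1 / (2 * τ)) = Y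
  generalize jacobiTheta₂ (1 / 2) (-1 / τ) = Z
  generalize (-I * τ) ^ (1 / 2 : ℂ) = g at *
  generalize cexp (-(π * I) / (8 * τ)) = F at *
  generalize cexp (π * I * τ / 2) = E at *
  generalize auxS τ = S
  have hI := Complex.I_ne_zero
  by_cases hX : X = 0
  · simp [hX]
  by_cases hY : Y = 0
  · simp [hY]
  field_simp
end
end
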